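/- arXiv:2005.09719 — 2 statements merged into one kernel-verified Lean document; each statement's English description precedes it below -/
import Mathlib

section
/- Let Q ⊆ ℝⁿ be a compact convex body with nonempty interior, and let c_Q = (∫_Q x dx)/Vol(Q) be its centroid. Let m ≥ 0 and v ∈ ℝⁿ be such that ⟨v,c_Q⟩ ≥ −m/(n+1), min_{x∈Q}⟨v,x⟩ = −1, and max_{y∈Q}⟨v,y⟩ ≥ ε for some ε > 0. Then Vol(Q_v⁺)/Vol(Q) ≥ ε/((ε+1)·e^{1+(m−1)/ε}) if m ≥ 1, and Vol(Q_v⁺)/Vol(Q) ≥ (ε+1−m)/((ε+1)·e) if 0 ≤ m < 1. -/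
open MeasureTheory InnerProductSpace
open scoped ENNReal Pointwise

theorem volume_add_le_of_isCompact {K L C : Set ℝ} (hK : IsCompact K) (hL : IsCompact L)
    (hKn : K.Nonempty) (hLn : L.Nonempty) (h : ∀ x ∈ K, ∀ y ∈ L, x + y ∈ C) :
    volume K + volume L ≤ volume C := by
  obtain ⟨a, haK, ha⟩ := hK.exists_isGreatest hKn
  obtain ⟨b, hbL, hb⟩ := hL.exists_isLeast hLn
  have e1 : volume ((fun x => x + b) '' K) = volume K := by simp
  have e2 : volume ((fun x => a + x) '' L) = volume L := by simp
  have hm : MeasurableSet ((fun x => a + x) '' L) :=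
    (hL.image (by fun_prop)).measurableSet
  have hd : AEDisjoint volume ((fun x => x + b) '' K) ((fun x => a + x) '' L) := by
    refine measure_mono_null ?_ (Real.volume_singleton (a := a + b))
    rintro _ ⟨⟨x, hx, rfl⟩, ⟨y, hy, hxy⟩⟩
    have := ha hx
    have := hb hy
    simp only at hxy
    simp only [Set.mem_singleton_iff]
    linarith
  rw [← e1, ← e2, ← measure_union₀ hm.nullMeasurableSet hd]
  refine measure_mono ?_
  rintro _ (⟨x, hx, rfl⟩ | ⟨y, hy, rfl⟩)
  · exact h x hx b hbL
  · exact h a haK y hy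

theorem volume_add_le_of_measurableSet {A B C : Set ℝ} (hA : MeasurableSet A)
    (hB : MeasurableSet B) (hAn : A.Nonempty) (hBn : B.Nonempty)
    (h : ∀ x ∈ A, ∀ y ∈ B, x + y ∈ C) :
    volume A + volume B ≤ volume C := by
  obtain ⟨a, ha⟩ := hAn
  obtain ⟨b, hb⟩ := hBn
  rw [hA.measure_eq_iSup_isCompact, hB.measure_eq_iSup_isCompact]
  simp only [iSup_and']
  refine ENNReal.biSup_add_biSup_le' ⟨∅, by simp⟩ ⟨∅, by simp⟩ ?_
  rintro K ⟨hKA, hK⟩ L ⟨hLB, hL⟩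
  refine (add_le_add (measure_mono (Set.subset_insert a K))
    (measure_mono (Set.subset_insert b L))).trans ?_
  refine volume_add_le_of_isCompact (hK.insert a) (hL.insert b) (Set.insert_nonempty _ _)
    (Set.insert_nonempty _ _) fun x hx y hy => h x ?_ y ?_
  · exact Set.insert_subset ha hKA hx
  · exact Set.insert_subset hb hLB hy

theorem volume_smul_add_smul_le {A B C : Set ℝ} (hA : MeasurableSet A)
    (hB : MeasurableSet B) (hAn : A.Nonempty) (hBn : B.Nonempty) {l : ℝ} (h0 : 0 < l) (h1 : l < 1)
    (h : ∀ x ∈ A, ∀ y ∈ B, l * x + (1 - l) * y ∈ C) :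
    ENNReal.ofReal l * volume A + ENNReal.ofReal (1 - l) * volume B ≤ volume C := by
  have h1' : 0 < 1 - l := by linarith
  have e1 := Measure.addHaar_smul (volume : Measure ℝ) l A
  have e2 := Measure.addHaar_smul (volume : Measure ℝ) (1 - l) B
  simp only [Module.finrank_self, pow_one, abs_of_pos h0, abs_of_pos h1'] at e1 e2
  rw [← e1, ← e2]
  refine volume_add_le_of_measurableSet (hA.const_smul₀ l) (hB.const_smul₀ _)
    hAn.smul_set hBn.smul_set ?_
  rintro _ ⟨x, hx, rfl⟩ _ ⟨y, hy, rfl⟩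
  exact h x hx y hy

theorem ENNReal.rpow_mul_rpow_le_add {a b : ℝ≥0∞} {l : ℝ} (h0 : 0 < l) (h1 : l < 1) :
    a ^ l * b ^ (1 - l) ≤ ENNReal.ofReal l * a + ENNReal.ofReal (1 - l) * b := by
  have h1' : 0 < 1 - l := by linarith
  have hl : ENNReal.ofReal l ≠ 0 := by simpa using h0
  have hl' : ENNReal.ofReal (1 - l) ≠ 0 := by simpa using h1
  rcases eq_or_ne a ⊤ with rfl | ha
  · simp [ENNReal.mul_top hl]
  rcases eq_or_ne b ⊤ with rfl | hb
  · simp [ENNReal.mul_top hl']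
  lift a to NNReal using ha
  lift b to NNReal using hb
  have := NNReal.geom_mean_le_arith_mean2_weighted l.toNNReal (1 - l).toNNReal a b (by
    rw [← Real.toNNReal_add h0.le h1'.le]; simp)
  rw [Real.coe_toNNReal _ h0.le, Real.coe_toNNReal _ h1'.le] at this
  rw [← ENNReal.coe_rpow_of_nonneg _ h0.le, ← ENNReal.coe_rpow_of_nonneg _ h1'.le]
  unfold ENNReal.ofReal
  exact_mod_cast this

theorem lintegral_eq_setLIntegral_Ioo_volume {k : ℝ → ℝ≥0∞} (hk : Measurable k)
    (h1 : ∀ x, k x ≤ 1) :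
    ∫⁻ x, k x = ∫⁻ t in Set.Ioo (0 : ℝ) 1, volume {x | ENNReal.ofReal t < k x} := by
  have hfin : ∀ x, k x ≠ ⊤ := fun x => ne_top_of_le_ne_top ENNReal.one_ne_top (h1 x)
  have h := lintegral_eq_lintegral_meas_lt (volume : Measure ℝ) (f := fun x => (k x).toReal)
    (Filter.Eventually.of_forall fun x => ENNReal.toReal_nonneg) hk.ennreal_toReal.aemeasurable
  simp only [ENNReal.ofReal_toReal (hfin _)] at h
  rw [h, ← lintegral_indicator measurableSet_Ioi, ← lintegral_indicator measurableSet_Ioo]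
  refine lintegral_congr fun t => ?_
  by_cases ht : t ∈ Set.Ioo (0 : ℝ) 1
  · rw [Set.indicator_of_mem ht, Set.indicator_of_mem (show t ∈ Set.Ioi (0 : ℝ) from ht.1)]
    simp only [ENNReal.ofReal_lt_iff_lt_toReal ht.1.le (hfin _)]
  · rw [Set.indicator_of_notMem ht]
    by_cases ht0 : t ∈ Set.Ioi (0 : ℝ)
    · rw [Set.indicator_of_mem ht0]
      have ht1 : 1 ≤ t := by
        by_contra! hlt
        exact ht ⟨ht0, hlt⟩
      convert measure_empty (μ := (volume : Measure ℝ))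
      ext x
      simp only [Set.mem_ofPred_eq, Set.mem_empty_iff_false, iff_false, not_lt]
      exact (ENNReal.toReal_le_of_le_ofReal zero_le_one (by simpa using h1 x)).trans ht1
    · rw [Set.indicator_of_notMem ht0]

theorem lintegral_add_le_of_iSup_eq_one {f g h : ℝ → ℝ≥0∞} (hf : Measurable f)
    (hg : Measurable g) (hh : Measurable h) {l : ℝ} (h0 : 0 < l) (h1 : l < 1)
    (hf1 : ⨆ x, f x = 1) (hg1 : ⨆ x, g x = 1)
    (H : ∀ x y, f x ^ l * g y ^ (1 - l) ≤ h (l * x + (1 - l) * y)) :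
    ENNReal.ofReal l * (∫⁻ x, f x) + ENNReal.ofReal (1 - l) * (∫⁻ x, g x) ≤ ∫⁻ x, h x := by
  have h1' : 0 < 1 - l := by linarith
  have hfle : ∀ x, f x ≤ 1 := fun x => hf1 ▸ le_iSup f x
  have hgle : ∀ x, g x ≤ 1 := fun x => hg1 ▸ le_iSup g x
  have hmin : ∫⁻ x, min (h x) 1 ≤ ∫⁻ x, h x := lintegral_mono fun x => min_le_left _ _
  refine le_trans ?_ hmin
  rw [lintegral_eq_setLIntegral_Ioo_volume hf hfle, lintegral_eq_setLIntegral_Ioo_volume hg hgle,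
    lintegral_eq_setLIntegral_Ioo_volume (hh.min measurable_const) fun x => min_le_right _ _]
  rw [← lintegral_const_mul' _ _ ENNReal.ofReal_ne_top,
    ← lintegral_const_mul' _ _ ENNReal.ofReal_ne_top]
  refine (le_lintegral_add _ _).trans ?_
  refine setLIntegral_mono' measurableSet_Ioo fun t ht => ?_
  have ht1 : ENNReal.ofReal t < 1 := by simpa using ht.2
  have ne1 : {x | ENNReal.ofReal t < f x}.Nonempty := by
    rw [← hf1] at ht1
    exact lt_iSup_iff.1 ht1
  have ne2 : {x | ENNReal.ofReal t < g x}.Nonempty := by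
    rw [← hg1] at ht1
    exact lt_iSup_iff.1 ht1
  refine volume_smul_add_smul_le (measurableSet_lt measurable_const hf)
    (measurableSet_lt measurable_const hg) ne1 ne2 h0 h1 ?_
  intro x hx y hy
  refine lt_min (lt_of_lt_of_le ?_ (H x y)) ht1
  have e : ENNReal.ofReal t = ENNReal.ofReal t ^ l * ENNReal.ofReal t ^ (1 - l) := by
    rw [← ENNReal.rpow_add_of_nonneg _ _ h0.le h1'.le]; simp
  rw [e]
  exact ENNReal.mul_lt_mul (ENNReal.rpow_lt_rpow hx h0) (ENNReal.rpow_lt_rpow hy h1')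

theorem prekopa_leindler_real_of_bounded {f g h : ℝ → ℝ≥0∞} (hf : Measurable f)
    (hg : Measurable g) (hh : Measurable h) {l : ℝ} (h0 : 0 < l) (h1 : l < 1)
    (hf1 : ⨆ x, f x ≠ ⊤) (hg1 : ⨆ x, g x ≠ ⊤)
    (H : ∀ x y, f x ^ l * g y ^ (1 - l) ≤ h (l * x + (1 - l) * y)) :
    (∫⁻ x, f x) ^ l * (∫⁻ x, g x) ^ (1 - l) ≤ ∫⁻ x, h x := by
  have h1' : 0 < 1 - l := by linarith
  set M := ⨆ x, f x with hM
  set N := ⨆ x, g x with hN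
  rcases eq_or_ne M 0 with hM0 | hM0
  · have : ∀ x, f x = 0 := by simpa using hM.symm.trans hM0
    simp [this, h0]
  rcases eq_or_ne N 0 with hN0 | hN0
  · have : ∀ x, g x = 0 := by simpa using hN.symm.trans hN0
    simp [this, h1]
  set c := M ^ l * N ^ (1 - l) with hc
  have hMl0 : M ^ l ≠ 0 := by simp [hM0, hf1]
  have hNl0 : N ^ (1 - l) ≠ 0 := by simp [hN0, hg1]
  have hMlt : M ^ l ≠ ⊤ := ENNReal.rpow_ne_top_of_nonneg h0.le hf1
  have hNlt : N ^ (1 - l) ≠ ⊤ := ENNReal.rpow_ne_top_of_nonneg h1'.le hg1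
  have hc0 : c ≠ 0 := mul_ne_zero hMl0 hNl0
  have hct : c ≠ ⊤ := ENNReal.mul_ne_top hMlt hNlt
  have hcinv : c⁻¹ = (M⁻¹) ^ l * (N⁻¹) ^ (1 - l) := by
    rw [hc, ENNReal.mul_inv (Or.inl hMl0) (Or.inl hMlt), ENNReal.inv_rpow, ENNReal.inv_rpow]
  have key := lintegral_add_le_of_iSup_eq_one (f := fun x => M⁻¹ * f x) (g := fun x => N⁻¹ * g x)
    (h := fun x => c⁻¹ * h x) (hf.const_mul _) (hg.const_mul _) (hh.const_mul _) h0 h1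
    (by rw [← ENNReal.mul_iSup, ← hM, ENNReal.inv_mul_cancel hM0 hf1])
    (by rw [← ENNReal.mul_iSup, ← hN, ENNReal.inv_mul_cancel hN0 hg1])
    (by
      intro x y
      rw [ENNReal.mul_rpow_of_nonneg _ _ h0.le, ENNReal.mul_rpow_of_nonneg _ _ h1'.le,
        mul_mul_mul_comm, ← hcinv]
      gcongr
      exact H x y)
  have key2 := (ENNReal.rpow_mul_rpow_le_add h0 h1).trans key
  rw [lintegral_const_mul _ hf, lintegral_const_mul _ hg, lintegral_const_mul _ hh,
    ENNReal.mul_rpow_of_nonneg _ _ h0.le, ENNReal.mul_rpow_of_nonneg _ _ h1'.le,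
    mul_mul_mul_comm, ← hcinv] at key2
  exact (ENNReal.mul_le_mul_iff_right (ENNReal.inv_ne_zero.2 hct) (ENNReal.inv_ne_top.2 hc0)).1 key2

theorem tendsto_lintegral_min_natCast {α : Type*} [MeasurableSpace α] {μ : Measure α}
    {f : α → ℝ≥0∞} (hf : Measurable f) :
    Filter.Tendsto (fun k : ℕ => ∫⁻ x, min (f x) k ∂μ) Filter.atTop (nhds (∫⁻ x, f x ∂μ)) := by
  refine lintegral_tendsto_of_tendsto_of_monotone
    (fun k => (hf.min measurable_const).aemeasurable)
    (Filter.Eventually.of_forall fun x i j hij => ?_)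
    (Filter.Eventually.of_forall fun x => ?_)
  · exact min_le_min_left _ (by exact_mod_cast hij)
  · have := (tendsto_const_nhds (x := f x)).min ENNReal.tendsto_nat_nhds_top
    simpa using this

theorem prekopa_leindler_real {f g h : ℝ → ℝ≥0∞} (hf : Measurable f)
    (hg : Measurable g) (hh : Measurable h) {l : ℝ} (h0 : 0 < l) (h1 : l < 1)
    (H : ∀ x y, f x ^ l * g y ^ (1 - l) ≤ h (l * x + (1 - l) * y)) :
    (∫⁻ x, f x) ^ l * (∫⁻ x, g x) ^ (1 - l) ≤ ∫⁻ x, h x := by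
  have h1' : 0 < 1 - l := by linarith
  rcases eq_or_ne (∫⁻ x, f x) 0 with hf0 | hf0
  · simp [hf0, h0]
  rcases eq_or_ne (∫⁻ x, g x) 0 with hg0 | hg0
  · simp [hg0, h1]
  have tf := ((ENNReal.continuous_rpow_const (y := l)).tendsto _).comp
    (tendsto_lintegral_min_natCast (μ := volume) hf)
  have tg := ((ENNReal.continuous_rpow_const (y := 1 - l)).tendsto _).comp
    (tendsto_lintegral_min_natCast (μ := volume) hg)
  refine le_of_tendsto (ENNReal.Tendsto.mul tf (Or.inl ?_) tg (Or.inl ?_))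
    (Filter.Eventually.of_forall fun k => ?_)
  · simp [hf0, h0.le, h0]
  · simp [hg0, h1.le]
  · refine prekopa_leindler_real_of_bounded (hf.min measurable_const) (hg.min measurable_const) hh
      h0 h1 ?_ ?_ fun x y => le_trans ?_ (H x y)
    · exact ne_top_of_le_ne_top (ENNReal.natCast_ne_top k) (iSup_le fun x => min_le_right _ _)
    · exact ne_top_of_le_ne_top (ENNReal.natCast_ne_top k) (iSup_le fun x => min_le_right _ _)
    · gcongr <;> exact min_le_left _ _

theorem prekopa_leindler (n : ℕ) {f g h : (Fin n → ℝ) → ℝ≥0∞} (hf : Measurable f)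
    (hg : Measurable g) (hh : Measurable h) {l : ℝ} (h0 : 0 < l) (h1 : l < 1)
    (H : ∀ x y, f x ^ l * g y ^ (1 - l) ≤ h (l • x + (1 - l) • y)) :
    (∫⁻ x, f x) ^ l * (∫⁻ x, g x) ^ (1 - l) ≤ ∫⁻ x, h x := by
  induction n with
  | zero =>
    have hv : (volume : Measure (Fin 0 → ℝ)) Set.univ = 1 := by
      rw [volume_pi, Measure.pi_univ]; simp
    simp only [lintegral_unique, hv, mul_one]
    convert H default default using 2 <;> congr!
  | succ n ih =>
    have hmp := (volume_preserving_piFinSuccAbove (fun _ : Fin (n + 1) => ℝ) 0).symm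
    set e := (MeasurableEquiv.piFinSuccAbove (fun _ : Fin (n + 1) => ℝ) 0).symm with he
    have hfubini : ∀ k : (Fin (n + 1) → ℝ) → ℝ≥0∞, Measurable k →
        ∫⁻ x, k x = ∫⁻ t, ∫⁻ y, k (e (t, y)) := by
      intro k hk
      rw [← hmp.lintegral_comp hk, Measure.volume_eq_prod,
        lintegral_prod (fun z => k (e z)) (hk.comp e.measurable).aemeasurable]
    have hlin : ∀ t s y z, e (l * t + (1 - l) * s, l • y + (1 - l) • z) =
        l • e (t, y) + (1 - l) • e (s, z) := by
      intro t s y z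
      ext i
      refine Fin.cases ?_ (fun j => ?_) i <;> simp [he, MeasurableEquiv.piFinSuccAbove]
    rw [hfubini f hf, hfubini g hg, hfubini h hh]
    refine prekopa_leindler_real (hf.comp e.measurable).lintegral_prod_right'
      (hg.comp e.measurable).lintegral_prod_right' (hh.comp e.measurable).lintegral_prod_right'
      h0 h1 fun t s => ?_
    refine ih (hf.comp (e.measurable.comp measurable_prodMk_left))
      (hg.comp (e.measurable.comp measurable_prodMk_left))
      (hh.comp (e.measurable.comp measurable_prodMk_left)) fun y z => ?_
    simp only [Function.comp_def, hlin]
    exact H _ _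

theorem volume_rpow_mul_volume_rpow_le {n : ℕ} {A B C : Set (EuclideanSpace ℝ (Fin n))}
    (hA : MeasurableSet A) (hB : MeasurableSet B) (hC : MeasurableSet C)
    {l : ℝ} (h0 : 0 < l) (h1 : l < 1)
    (H : ∀ x ∈ A, ∀ y ∈ B, l • x + (1 - l) • y ∈ C) :
    volume A ^ l * volume B ^ (1 - l) ≤ volume C := by
  have hmp := PiLp.volume_preserving_toLp (Fin n)
  have hm := hmp.measurable
  rw [← hmp.measure_preimage hA.nullMeasurableSet, ← hmp.measure_preimage hB.nullMeasurableSet,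
    ← hmp.measure_preimage hC.nullMeasurableSet, ← lintegral_indicator_one (hm hA),
    ← lintegral_indicator_one (hm hB), ← lintegral_indicator_one (hm hC)]
  refine prekopa_leindler n (measurable_one.indicator (hm hA)) (measurable_one.indicator (hm hB))
    (measurable_one.indicator (hm hC)) h0 h1 fun x y => ?_
  by_cases hx : WithLp.toLp 2 x ∈ A
  · by_cases hy : WithLp.toLp 2 y ∈ B
    · have hz := H _ hx _ hy
      have hz' : l • x + (1 - l) • y ∈ WithLp.toLp 2 ⁻¹' C := by
        simpa only [Set.mem_preimage, WithLp.toLp_add, WithLp.toLp_smul] using hz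
      rw [Set.indicator_of_mem hz', Set.indicator_of_mem (show x ∈ WithLp.toLp 2 ⁻¹' A from hx),
        Set.indicator_of_mem (show y ∈ WithLp.toLp 2 ⁻¹' B from hy)]
      simp
    · rw [Set.indicator_of_notMem (show y ∉ WithLp.toLp 2 ⁻¹' B from hy)]
      simp [h1]
  · rw [Set.indicator_of_notMem (show x ∉ WithLp.toLp 2 ⁻¹' A from hx)]
    simp [h0]

theorem measureReal_smul_le_of_translate {n : ℕ} {A C : Set (EuclideanSpace ℝ (Fin n))}
    (hC : volume C ≠ ⊤) {l : ℝ} (h0 : 0 < l) (z : EuclideanSpace ℝ (Fin n))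
    (H : ∀ x ∈ A, l • x + z ∈ C) :
    l ^ n * volume.real A ≤ volume.real C := by
  have e : volume.real ((fun x => x + z) '' (l • A)) = l ^ n * volume.real A := by
    have h2 := Measure.addHaar_smul (volume : Measure (EuclideanSpace ℝ (Fin n))) l A
    simp only [Measure.real, Set.image_add_right,
      measure_preimage_add_right]
    rw [h2, finrank_euclideanSpace_fin, ENNReal.toReal_mul, abs_of_pos (pow_pos h0 n),
      ENNReal.toReal_ofReal (pow_pos h0 n).le]
  rw [← e]
  refine measureReal_mono ?_ hC
  rintro _ ⟨_, ⟨x, hx, rfl⟩, rfl⟩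
  exact H x hx

theorem brunn_minkowski {n : ℕ} (hn : n ≠ 0) {A B C : Set (EuclideanSpace ℝ (Fin n))}
    (hA : MeasurableSet A) (hB : MeasurableSet B) (hC : MeasurableSet C)
    (hAt : volume A ≠ ⊤) (hBt : volume B ≠ ⊤) (hCt : volume C ≠ ⊤)
    (hAn : A.Nonempty) (hBn : B.Nonempty) {l : ℝ} (h0 : 0 < l) (h1 : l < 1)
    (H : ∀ x ∈ A, ∀ y ∈ B, l • x + (1 - l) • y ∈ C) :
    l * volume.real A ^ (n⁻¹ : ℝ) + (1 - l) * volume.real B ^ (n⁻¹ : ℝ) ≤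
      volume.real C ^ (n⁻¹ : ℝ) := by
  have h1' : 0 < 1 - l := by linarith
  have hninv : (n⁻¹ : ℝ) ≠ 0 := by positivity
  have hCnn : 0 ≤ volume.real C := measureReal_nonneg
  rw [Real.le_rpow_inv_iff_of_pos (by positivity) hCnn (by positivity), Real.rpow_natCast]
  set α := volume.real A ^ (n⁻¹ : ℝ) with hα
  set β := volume.real B ^ (n⁻¹ : ℝ) with hβ
  have hαn : α ^ n = volume.real A := Real.rpow_inv_natCast_pow measureReal_nonneg hn
  have hβn : β ^ n = volume.real B := Real.rpow_inv_natCast_pow measureReal_nonneg hn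
  have hα0 : 0 ≤ α := by positivity
  have hβ0 : 0 ≤ β := by positivity
  obtain ⟨a, ha⟩ := hAn
  obtain ⟨b, hb⟩ := hBn
  rcases hα0.eq_or_lt with hα0 | hα0
  · rw [← hα0, mul_zero, zero_add, mul_pow, hβn]
    refine measureReal_smul_le_of_translate hCt h1' (l • a) fun y hy => ?_
    rw [add_comm]
    exact H a ha y hy
  rcases hβ0.eq_or_lt with hβ0 | hβ0
  · rw [← hβ0, mul_zero, add_zero, mul_pow, hαn]
    exact measureReal_smul_le_of_translate hCt h0 ((1 - l) • b) fun x hx => H x hx b hb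
  set γ := l * α + (1 - l) * β with hγ
  have hγ0 : 0 < γ := by positivity
  have hsc : ∀ (r : ℝ) (_ : 0 < r) (S : Set (EuclideanSpace ℝ (Fin n))),
      volume (r⁻¹ • S) = ENNReal.ofReal (r⁻¹ ^ n) * volume S := by
    intro r hr S
    rw [Measure.addHaar_smul, finrank_euclideanSpace_fin, abs_of_pos (by positivity)]
  have hone : ∀ (r : ℝ) (_ : 0 < r) (S : Set (EuclideanSpace ℝ (Fin n))),
      volume S ≠ ⊤ → r ^ n = volume.real S → volume (r⁻¹ • S) = 1 := by
    intro r hr S hS hrS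
    rw [hsc r hr, ← ENNReal.ofReal_toReal hS, ← measureReal_def, ← hrS,
      ← ENNReal.ofReal_mul (by positivity), ← mul_pow, inv_mul_cancel₀ hr.ne']
    simp
  have hl : l * α / γ < 1 := by
    rw [div_lt_one hγ0, hγ]
    have := mul_pos h1' hβ0
    linarith
  have key := volume_rpow_mul_volume_rpow_le (A := α⁻¹ • A) (B := β⁻¹ • B) (C := γ⁻¹ • C)
    (hA.const_smul₀ _) (hB.const_smul₀ _) (hC.const_smul₀ _) (l := l * α / γ)
    (by positivity) hl (by
      rintro _ ⟨x, hx, rfl⟩ _ ⟨y, hy, rfl⟩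
      refine ⟨l • x + (1 - l) • y, H x hx y hy, ?_⟩
      simp only [smul_add, smul_smul]
      congr 2
      · field_simp
      · field_simp
        rw [hγ]; ring)
  rw [hone α hα0 A hAt hαn, hone β hβ0 B hBt hβn, hsc γ hγ0, ENNReal.one_rpow, ENNReal.one_rpow,
    one_mul, ← ENNReal.ofReal_toReal hCt, ← ENNReal.ofReal_mul (by positivity),
    ENNReal.one_le_ofReal, inv_pow, ← measureReal_def] at key
  rwa [inv_mul_eq_div, one_le_div (by positivity)] at key

theorem exists_affine_pow_bound {G : ℝ → ℝ} {n : ℕ} (hn : n ≠ 0) {M : ℝ} (hM : 0 < M)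
    (hG0 : ∀ t, 0 ≤ G t) (hG1 : G (-1) = 1) (hGM : ∀ t, M < t → G t = 0) (hp1 : G 0 < 1)
    (hconc : ∀ t u, -1 ≤ t → t < 0 → 0 < u → u ≤ M →
      u * G t ^ (n⁻¹ : ℝ) + -t * G u ^ (n⁻¹ : ℝ) ≤ (u - t) * G 0 ^ (n⁻¹ : ℝ)) :
    ∃ b, M ≤ b ∧ ∀ t, -1 ≤ t → t ≤ b → G t ≤ G 0 * (1 - t / b) ^ n := by
  set g : ℝ → ℝ := fun t => G t ^ (n⁻¹ : ℝ) with hg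
  have hgn : ∀ t, g t ^ n = G t := fun t => Real.rpow_inv_natCast_pow (hG0 t) hn
  have hg0 : ∀ t, 0 ≤ g t := fun t => Real.rpow_nonneg (hG0 t) _
  have hgm1 : g (-1) = 1 := by simp [hg, hG1]
  have ha1 : g 0 < 1 := Real.rpow_lt_one (hG0 0) hp1 (by positivity)
  change ∀ t u, -1 ≤ t → t < 0 → 0 < u → u ≤ M →
      u * g t + -t * g u ≤ (u - t) * g 0 at hconc
  set S : Set ℝ := (fun t => (g t - g 0) / (-t)) '' Set.Ico (-1) 0 with hS
  have hub : ∀ u, 0 < u → u ≤ M → (g 0 - g u) / u ∈ upperBounds S := by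
    rintro u hu huM _ ⟨t, ⟨ht1, ht0⟩, rfl⟩
    have := hconc t u ht1 ht0 hu huM
    simp only
    rw [div_le_div_iff₀ (by linarith) hu]
    nlinarith
  have hbdd : BddAbove S := ⟨_, hub M hM le_rfl⟩
  have hmem : ∀ t, -1 ≤ t → t < 0 → (g t - g 0) / (-t) ≤ sSup S := fun t h1 h0 =>
    le_csSup hbdd ⟨t, ⟨h1, h0⟩, rfl⟩
  have hne : S.Nonempty := ⟨_, -1, ⟨le_rfl, by norm_num⟩, rfl⟩
  have hs : 0 < sSup S := by
    have := hmem (-1) le_rfl (by norm_num)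
    simp only [hgm1, neg_neg, div_one] at this
    linarith
  have hsM : sSup S ≤ g 0 / M := by
    refine (csSup_le hne (hub M hM le_rfl)).trans ?_
    gcongr
    linarith [hg0 M]
  have ha : 0 < g 0 := by
    have := hs.trans_le hsM
    rcases (hg0 0).eq_or_lt with h | h
    · rw [← h] at this; simp at this
    · exact h
  have hb : M ≤ g 0 / sSup S := by
    rw [le_div_iff₀ hs]
    rwa [le_div_iff₀ hM, mul_comm] at hsM
  refine ⟨g 0 / sSup S, hb, fun t ht1 htb => ?_⟩
  have hline : g t ≤ g 0 - sSup S * t := by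
    rcases lt_trichotomy t 0 with h | h | h
    · have := hmem t ht1 h
      rw [div_le_iff₀ (by linarith)] at this
      linarith
    · simp [h]
    · rcases le_or_gt t M with htM | htM
      · have := csSup_le hne (hub t h htM)
        rw [le_div_iff₀ h] at this
        linarith
      · have : g t = 0 := by simp [hg, hGM t htM, hn]
        rw [this]
        rw [le_div_iff₀ hs] at htb
        linarith
  calc G t = g t ^ n := (hgn t).symm
    _ ≤ (g 0 - sSup S * t) ^ n := pow_le_pow_left₀ (hg0 t) hline n
    _ = (g 0 * (1 - t / (g 0 / sSup S))) ^ n := by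
        congr 1
        field_simp
    _ = G 0 * (1 - t / (g 0 / sSup S)) ^ n := by rw [mul_pow, hgn]

theorem integral_div_pow (n : ℕ) {c : ℝ} (hc : c ≠ 0) :
    ∫ r in (0 : ℝ)..c, (r / c) ^ n = c / (n + 1) := by
  have hn : (n : ℝ) + 1 ≠ 0 := by positivity
  simp only [div_pow]
  rw [intervalIntegral.integral_div, integral_pow]
  field_simp
  simp [pow_succ]

theorem integral_one_sub_div_pow (n : ℕ) {b τ : ℝ} (hb : b ≠ 0) :
    ∫ r in (1 - τ)..(1 + b), (1 - (r - 1) / b) ^ n = b * (1 + τ / b) ^ (n + 1) / (n + 1) := by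
  have hn : (n : ℝ) + 1 ≠ 0 := by positivity
  have hd : ∀ r : ℝ, HasDerivAt (fun r => -(b * (1 - (r - 1) / b) ^ (n + 1) / (n + 1)))
      ((1 - (r - 1) / b) ^ n) r := by
    intro r
    have h := (((((hasDerivAt_id r).sub_const 1).div_const b).const_sub 1).pow (n + 1)).const_mul
      b |>.div_const ((n : ℝ) + 1) |>.neg
    refine h.congr_deriv ?_
    simp only [id_eq, Nat.cast_add, Nat.cast_one, add_tsub_cancel_right]
    field_simp
  rw [intervalIntegral.integral_eq_sub_of_hasDerivAt (fun r _ => hd r)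
    (Continuous.intervalIntegrable (by fun_prop) _ _)]
  have e1 : 1 - (1 + b - 1) / b = 0 := by field_simp; ring
  have e2 : 1 - (1 - τ - 1) / b = 1 + τ / b := by ring
  rw [e1, e2]
  simp

theorem integral_tail_le {G : ℝ → ℝ} {n : ℕ} {b τ : ℝ} (hb : 0 < b) (hτ0 : 0 ≤ τ) (hτ1 : τ < 1)
    (hanti : Antitone G) (hGb : ∀ t, b < t → G t = 0)
    (hbound : ∀ t, -1 ≤ t → t ≤ b → G t ≤ G 0 * (1 - t / b) ^ n)
    (hstar : ∀ t s, -1 ≤ t → t ≤ s → -1 < s → s ≤ 0 →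
      ((1 + t) / (1 + s)) ^ n * (1 - G s) ≤ 1 - G t) :
    (n + 1) * ∫ r in Set.Ioi (0 : ℝ), G (r - 1) ≤
      n * (1 - τ) + G 0 * (1 + τ / b) ^ n * (1 + b) := by
  have hsplit : ∫ r in Set.Ioi (0 : ℝ), G (r - 1) =
      (∫ r in (0 : ℝ)..(1 - τ), G (r - 1)) + ∫ r in (1 - τ)..(1 + b), G (r - 1) := by
    have hGint : ∀ x y, IntervalIntegrable (fun r => G (r - 1)) volume x y := fun x y =>
      Antitone.intervalIntegrable fun r s hrs => hanti (by linarith)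
    rw [intervalIntegral.integral_add_adjacent_intervals (hGint _ _) (hGint _ _),
      intervalIntegral.integral_of_le (by linarith)]
    refine setIntegral_eq_of_subset_of_forall_sdiff_eq_zero measurableSet_Ioi
      (fun r hr => hr.1) fun r hr => hGb _ ?_
    by_contra! hlt
    exact hr.2 ⟨hr.1, by linarith⟩
  have hanti' : Antitone fun r => G (r - 1) := fun r s hrs => hanti (by linarith)
  have hn : (0 : ℝ) < n + 1 := by positivity
  set D := 1 - G 0 * (1 + τ / b) ^ n with hD
  have hGτ : D ≤ 1 - G (-τ) := by
    have := hbound (-τ) (by linarith) (by linarith)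
    rw [neg_div, sub_neg_eq_add] at this
    linarith
  have h1 : ∫ r in (0 : ℝ)..(1 - τ), G (r - 1) ≤ (1 - τ) - (1 - τ) / (n + 1) * D := by
    calc ∫ r in (0 : ℝ)..(1 - τ), G (r - 1)
        ≤ ∫ r in (0 : ℝ)..(1 - τ), (1 - (r / (1 - τ)) ^ n * D) := by
          refine intervalIntegral.integral_mono_on (by linarith) hanti'.intervalIntegrable
            (Continuous.intervalIntegrable (by fun_prop) _ _) fun r hr => ?_
          have := hstar (r - 1) (-τ) (by linarith [hr.1]) (by linarith [hr.2]) (by linarith)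
            (by linarith)
          have e : (1 + (r - 1)) / (1 + -τ) = r / (1 - τ) := by ring_nf
          rw [e] at this
          have hnn : 0 ≤ (r / (1 - τ)) ^ n := pow_nonneg (div_nonneg hr.1 (by linarith)) _
          nlinarith
      _ = (1 - τ) - (1 - τ) / (n + 1) * D := by
          rw [intervalIntegral.integral_sub (by simp)
            (Continuous.intervalIntegrable (by fun_prop) _ _),
            intervalIntegral.integral_mul_const, integral_div_pow n (by linarith)]
          simp
  have h2 : ∫ r in (1 - τ)..(1 + b), G (r - 1) ≤
      G 0 * (b * (1 + τ / b) ^ (n + 1) / (n + 1)) := by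
    rw [← integral_one_sub_div_pow n hb.ne', ← intervalIntegral.integral_const_mul]
    refine intervalIntegral.integral_mono_on (by linarith) hanti'.intervalIntegrable
      (Continuous.intervalIntegrable (by fun_prop) _ _) fun r hr => ?_
    exact hbound _ (by linarith [hr.1]) (by linarith [hr.2])
  rw [hsplit]
  calc (n + 1) * ((∫ r in (0 : ℝ)..(1 - τ), G (r - 1)) + ∫ r in (1 - τ)..(1 + b), G (r - 1))
      ≤ (n + 1) * (((1 - τ) - (1 - τ) / (n + 1) * D) +
          G 0 * (b * (1 + τ / b) ^ (n + 1) / (n + 1))) := by gcongr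
    _ = n * (1 - τ) + G 0 * (1 + τ / b) ^ n * (1 + b) := by
        rw [hD, pow_succ]
        field_simp
        ring

theorem div_mul_exp_le_of_le_mul_pow {n : ℕ} (hn : n ≠ 0) {p b τ m : ℝ} (hb : 0 < b) (hτ : 0 ≤ τ)
    (hτm : (n - 1) * τ ≤ b - 1 + m) (h : b + τ ≤ p * (1 + τ / b) ^ n * (1 + b)) :
    b / (b + 1) * Real.exp (-(1 + (m - 1) / b)) ≤ p := by
  obtain ⟨k, rfl⟩ := Nat.exists_eq_succ_of_ne_zero hn
  have hR : 0 < 1 + τ / b := by positivity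
  have hexp : (1 + τ / b) ^ k ≤ Real.exp (1 + (m - 1) / b) := by
    calc (1 + τ / b) ^ k ≤ Real.exp (τ / b) ^ k := by
          gcongr
          linarith [Real.add_one_le_exp (τ / b)]
      _ = Real.exp (k * (τ / b)) := by rw [← Real.exp_nat_mul]
      _ ≤ Real.exp (1 + (m - 1) / b) := by
          rw [Real.exp_le_exp, ← mul_div_assoc, div_le_iff₀ hb, add_mul, div_mul_cancel₀ _ hb.ne']
          push_cast at hτm
          linarith
  have h3 : b ≤ p * (1 + τ / b) ^ k * (1 + b) := by
    have e : b + τ = b * (1 + τ / b) := by field_simp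
    rw [e, Nat.succ_eq_add_one, pow_succ] at h
    refine le_of_mul_le_mul_right (h.trans_eq ?_) hR
    ring
  have hp : 0 ≤ p := by
    by_contra! hp
    have : p * (1 + τ / b) ^ k * (1 + b) < 0 :=
      mul_neg_of_neg_of_pos (mul_neg_of_neg_of_pos hp (by positivity)) (by positivity)
    linarith
  rw [Real.exp_neg, ← div_eq_mul_inv, div_le_iff₀ (Real.exp_pos _), div_le_iff₀ (by positivity)]
  calc b ≤ p * (1 + τ / b) ^ k * (1 + b) := h3
    _ ≤ p * Real.exp (1 + (m - 1) / b) * (1 + b) := by gcongr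
    _ = p * Real.exp (1 + (m - 1) / b) * (b + 1) := by ring

theorem tail_lower_bound {G : ℝ → ℝ} {n : ℕ} (hn : n ≠ 0) {M m ε : ℝ} (hε : 0 < ε) (hεM : ε ≤ M)
    (hm : 0 ≤ m) (hanti : Antitone G) (hG0 : ∀ t, 0 ≤ G t) (hG1 : G (-1) = 1)
    (hGM : ∀ t, M < t → G t = 0)
    (hconc : ∀ t u, -1 ≤ t → t < 0 → 0 < u → u ≤ M →
      u * G t ^ (n⁻¹ : ℝ) + -t * G u ^ (n⁻¹ : ℝ) ≤ (u - t) * G 0 ^ (n⁻¹ : ℝ))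
    (hstar : ∀ t s, -1 ≤ t → t ≤ s → -1 < s → s ≤ 0 →
      ((1 + t) / (1 + s)) ^ n * (1 - G s) ≤ 1 - G t)
    (hmean : 1 - m / (n + 1) ≤ ∫ r in Set.Ioi (0 : ℝ), G (r - 1)) :
    (1 ≤ m → ε / ((ε + 1) * Real.exp (1 + (m - 1) / ε)) ≤ G 0) ∧
    (m < 1 → (ε + 1 - m) / ((ε + 1) * Real.exp 1) ≤ G 0) := by
  have hn1 : (1 : ℝ) ≤ n := by exact_mod_cast Nat.one_le_iff_ne_zero.2 hn
  have he2 : (2 : ℝ) ≤ Real.exp 1 := by linarith [Real.exp_one_gt_d9]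
  rcases le_or_gt 1 (G 0) with hp1 | hp1
  · refine ⟨fun hm1 => le_trans ?_ hp1, fun hm1 => le_trans ?_ hp1⟩
    · rw [div_le_one (by positivity)]
      have : 1 ≤ Real.exp (1 + (m - 1) / ε) :=
        Real.one_le_exp (add_nonneg zero_le_one (div_nonneg (by linarith) hε.le))
      nlinarith
    · rw [div_le_one (by positivity)]
      nlinarith
  obtain ⟨b, hMb, hbound⟩ := exists_affine_pow_bound hn (hε.trans_le hεM) hG0 hG1 hGM hp1 hconc
  have hεb : ε ≤ b := hεM.trans hMb
  have hb : 0 < b := hε.trans_le hεb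
  have hkey : ∀ τ, 0 ≤ τ → τ < 1 → 1 - m + n * τ ≤ G 0 * (1 + τ / b) ^ n * (1 + b) := by
    intro τ h0 h1
    have h2 := integral_tail_le hb h0 h1 hanti (fun t ht => hGM t (hMb.trans_lt ht)) hbound hstar
    have h3 := mul_le_mul_of_nonneg_left hmean (show (0 : ℝ) ≤ n + 1 by positivity)
    have h4 : ((n : ℝ) + 1) * (1 - m / (n + 1)) = n + 1 - m := by field_simp
    linarith
  have hmain : 0 ≤ b - 1 + m → b / (b + 1) * Real.exp (-(1 + (m - 1) / b)) ≤ G 0 := by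
    intro hbm
    rcases le_or_gt ((n : ℝ) - 1) (b - 1 + m) with hle | hlt
    · refine div_mul_exp_le_of_le_mul_pow hn hb zero_le_one (by linarith) ?_
      have := hbound (-1) le_rfl (by linarith)
      rw [hG1, neg_div, sub_neg_eq_add] at this
      nlinarith
    · have hn1' : (0 : ℝ) < n - 1 := by linarith
      have hτ : ((n : ℝ) - 1) * ((b - 1 + m) / (n - 1)) = b - 1 + m := by field_simp
      have h0 : 0 ≤ (b - 1 + m) / ((n : ℝ) - 1) := div_nonneg hbm hn1'.le
      refine div_mul_exp_le_of_le_mul_pow hn hb h0 hτ.le ?_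
      refine le_trans ?_ (hkey _ h0 ((div_lt_one hn1').2 hlt))
      linarith
  refine ⟨fun hm1 => ?_, fun hm1 => ?_⟩
  · refine le_trans ?_ (hmain (by linarith))
    have e : ε / ((ε + 1) * Real.exp (1 + (m - 1) / ε)) =
        ε / (ε + 1) * Real.exp (-(1 + (m - 1) / ε)) := by
      rw [Real.exp_neg]
      field_simp
    rw [e]
    have h1 : ε / (ε + 1) ≤ b / (b + 1) := by
      rw [div_le_div_iff₀ (by positivity) (by positivity)]
      nlinarith
    have h2 : (m - 1) / b ≤ (m - 1) / ε :=
      div_le_div_of_nonneg_left (by linarith) hε hεb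
    gcongr
  · have hmono : (ε + 1 - m) / ((ε + 1) * Real.exp 1) ≤ (b + 1 - m) / ((b + 1) * Real.exp 1) := by
      rw [← div_div, ← div_div]
      gcongr ?_ / _
      rw [div_le_div_iff₀ (by positivity) (by positivity)]
      nlinarith
    refine hmono.trans ?_
    rcases le_or_gt (b - 1 + m) 0 with hle | hgt
    · have := hkey 0 le_rfl zero_lt_one
      simp only [mul_zero, add_zero, zero_div, one_pow, mul_one] at this
      rw [div_le_iff₀ (by positivity)]
      nlinarith
    · refine le_trans ?_ (hmain hgt.le)
      have e : -(1 + (m - 1) / b) = (1 - m) / b + -1 := by ring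
      have h1 := Real.add_one_le_exp ((1 - m) / b)
      rw [e, Real.exp_add, Real.exp_neg]
      calc (b + 1 - m) / ((b + 1) * Real.exp 1)
          = b / (b + 1) * (((1 - m) / b + 1) * (Real.exp 1)⁻¹) := by
            field_simp
            ring
        _ ≤ _ := by gcongr

theorem pow_mul_measureReal_lt_le {n : ℕ} {Q : Set (EuclideanSpace ℝ (Fin n))}
    (hQc : IsCompact Q) (hQ : Convex ℝ Q) {v x₀ : EuclideanSpace ℝ (Fin n)} (hx₀ : x₀ ∈ Q)
    (hvx₀ : ⟪v, x₀⟫_ℝ = -1) {t s : ℝ} (ht : -1 < t) (hts : t ≤ s) :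
    ((1 + t) / (1 + s)) ^ n * volume.real {x ∈ Q | ⟪v, x⟫_ℝ < s} ≤
      volume.real {x ∈ Q | ⟪v, x⟫_ℝ < t} := by
  have h1 : 0 < 1 + t := by linarith
  have h2 : 0 < 1 + s := by linarith
  have h3 : (1 + t) / (1 + s) ≤ 1 := (div_le_one h2).2 (by linarith)
  have h4 : 0 < (1 + t) / (1 + s) := by positivity
  refine measureReal_smul_le_of_translate
    (ne_top_of_le_ne_top hQc.measure_ne_top (measure_mono (Set.sep_subset _ _))) h4
    ((1 - (1 + t) / (1 + s)) • x₀) ?_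
  rintro x ⟨hx, hxs⟩
  refine ⟨hQ hx hx₀ h4.le (by linarith) (by ring), ?_⟩
  rw [inner_add_right, inner_smul_right, inner_smul_right, hvx₀]
  have h5 : (1 + t) / (1 + s) * (1 + ⟪v, x⟫_ℝ) < (1 + t) / (1 + s) * (1 + s) := by gcongr
  rw [div_mul_cancel₀ _ h2.ne'] at h5
  linarith

theorem measurableSet_sep_le_inner {n : ℕ} {Q : Set (EuclideanSpace ℝ (Fin n))}
    (hQ : MeasurableSet Q) (v : EuclideanSpace ℝ (Fin n)) (t : ℝ) :
    MeasurableSet {x ∈ Q | t ≤ ⟪v, x⟫_ℝ} :=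
  hQ.inter (measurableSet_le (f := fun _ : EuclideanSpace ℝ (Fin n) => t)
    (g := fun x => ⟪v, x⟫_ℝ) measurable_const (by fun_prop))

theorem measureReal_halfspace_brunn_minkowski {n : ℕ} (hn : n ≠ 0)
    {Q : Set (EuclideanSpace ℝ (Fin n))}
    (hQc : IsCompact Q) (hQ : Convex ℝ Q) {v y₀ : EuclideanSpace ℝ (Fin n)} (hy₀ : y₀ ∈ Q)
    {t u : ℝ} (ht : t < 0) (hu : 0 < u) (huy : u ≤ ⟪v, y₀⟫_ℝ) :
    u * volume.real {x ∈ Q | t ≤ ⟪v, x⟫_ℝ} ^ (n⁻¹ : ℝ) +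
        -t * volume.real {x ∈ Q | u ≤ ⟪v, x⟫_ℝ} ^ (n⁻¹ : ℝ) ≤
      (u - t) * volume.real {x ∈ Q | 0 ≤ ⟪v, x⟫_ℝ} ^ (n⁻¹ : ℝ) := by
  have hmeas := measurableSet_sep_le_inner hQc.measurableSet v
  have hfin : ∀ t, volume {x ∈ Q | t ≤ ⟪v, x⟫_ℝ} ≠ ⊤ := fun t =>
    ne_top_of_le_ne_top hQc.measure_ne_top (measure_mono (Set.sep_subset _ _))
  have hut : 0 < u - t := by linarith
  have hl1 : u / (u - t) < 1 := (div_lt_one hut).2 (by linarith)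
  have hl' : 1 - u / (u - t) = -t / (u - t) := by field_simp; ring
  have key := brunn_minkowski hn (hmeas t) (hmeas u) (hmeas 0) (hfin t) (hfin u) (hfin 0)
    ⟨y₀, hy₀, by linarith⟩ ⟨y₀, hy₀, huy⟩ (l := u / (u - t)) (by positivity) hl1 (by
      rintro x ⟨hx, hxt⟩ y ⟨hy, hyu⟩
      refine ⟨hQ hx hy (by positivity) (by linarith) (by ring), ?_⟩
      rw [inner_add_right, inner_smul_right, inner_smul_right, hl']
      have e : u / (u - t) * ⟪v, x⟫_ℝ + -t / (u - t) * ⟪v, y⟫_ℝ =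
          (u * (⟪v, x⟫_ℝ - t) + -t * (⟪v, y⟫_ℝ - u)) / (u - t) := by ring
      rw [e]
      exact div_nonneg (add_nonneg (mul_nonneg hu.le (by linarith))
        (mul_nonneg (by linarith) (by linarith))) hut.le)
  rw [hl', div_mul_eq_mul_div, div_mul_eq_mul_div, ← add_div, div_le_iff₀ hut] at key
  linarith

theorem integral_measureReal_halfspace {n : ℕ} {Q : Set (EuclideanSpace ℝ (Fin n))}
    (hQc : IsCompact Q) {v : EuclideanSpace ℝ (Fin n)} (hv : ∀ x ∈ Q, -1 ≤ ⟪v, x⟫_ℝ) :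
    ∫ r in Set.Ioi (0 : ℝ), volume.real {x ∈ Q | r - 1 ≤ ⟪v, x⟫_ℝ} =
      ⟪v, ∫ x in Q, x⟫_ℝ + volume.real Q := by
  have hid : IntegrableOn (fun x : EuclideanSpace ℝ (Fin n) => x) Q :=
    continuousOn_id.integrableOn_compact hQc
  have hin : IntegrableOn (fun x => ⟪v, x⟫_ℝ) Q := hid.const_inner v
  have hone : IntegrableOn (fun _ : EuclideanSpace ℝ (Fin n) => (1 : ℝ)) Q :=
    continuousOn_const.integrableOn_compact hQc
  have h := Integrable.integral_eq_integral_meas_le (μ := volume.restrict Q)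
    (f := fun x => ⟪v, x⟫_ℝ + 1) (hin.add hone)
    ((ae_restrict_iff' hQc.measurableSet).2 (Filter.Eventually.of_forall fun x hx => by
      have := hv x hx
      simp only [Pi.zero_apply]
      linarith))
  rw [integral_add hin hone, integral_inner hid] at h
  simp only [integral_const, smul_eq_mul, mul_one, measureReal_restrict_apply_univ] at h
  rw [h]
  refine setIntegral_congr_fun measurableSet_Ioi fun r _ => ?_
  rw [measureReal_restrict_apply (measurableSet_le measurable_const (by fun_prop))]
  congr 1
  ext x
  simp only [Set.mem_inter_iff, Set.mem_ofPred_eq, sub_le_iff_le_add]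
  exact and_comm

/-- Let `Q ⊆ ℝⁿ` be a compact convex body with nonempty interior and
centroid `c_Q = (∫_Q x dx)/Vol(Q)`.  Let `m ≥ 0` and `v` be such that
`⟨v,c_Q⟩ ≥ −m/(n+1)`, `min_{x∈Q}⟨v,x⟩ = −1` and `max_{y∈Q}⟨v,y⟩ ≥ ε > 0`.  Then
`Vol(Q_v⁺)/Vol(Q) ≥ ε/((ε+1)e^{1+(m−1)/ε})` if `m ≥ 1`, and
`Vol(Q_v⁺)/Vol(Q) ≥ (ε+1−m)/((ε+1)e)` if `0 ≤ m < 1`. -/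
theorem stmt9 (n : ℕ) (Q : Set (EuclideanSpace ℝ (Fin n)))
    (hQcompact : IsCompact Q) (hQconvex : Convex ℝ Q)
    (hQint : (interior Q).Nonempty)
    (m : ℝ) (hm : 0 ≤ m) (v : EuclideanSpace ℝ (Fin n)) (ε : ℝ) (hε : 0 < ε)
    (hcent : -m / ((n : ℝ) + 1) ≤
      ⟪v, ((volume Q).toReal)⁻¹ • ∫ x in Q, x⟫_ℝ)
    (hminle : ∀ x ∈ Q, -1 ≤ ⟪v, x⟫_ℝ) (hminmem : ∃ x ∈ Q, ⟪v, x⟫_ℝ = -1)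
    (hmax : ∃ y ∈ Q, ε ≤ ⟪v, y⟫_ℝ) :
    (1 ≤ m →
      ε / ((ε + 1) * Real.exp (1 + (m - 1) / ε)) ≤
        (volume {x ∈ Q | 0 ≤ ⟪v, x⟫_ℝ}).toReal / (volume Q).toReal) ∧
    (m < 1 →
      (ε + 1 - m) / ((ε + 1) * Real.exp 1) ≤
        (volume {x ∈ Q | 0 ≤ ⟪v, x⟫_ℝ}).toReal / (volume Q).toReal) := by
  have hn : n ≠ 0 := by
    rintro rfl
    obtain ⟨x, _, hx⟩ := hminmem
    rw [Subsingleton.elim x 0, inner_zero_right] at hx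
    norm_num at hx
  have hV : 0 < volume.real Q :=
    ENNReal.toReal_pos (Measure.measure_pos_of_nonempty_interior _ hQint).ne' hQcompact.measure_ne_top
  obtain ⟨y₀, hy₀, hy₀max⟩ := hQcompact.exists_isMaxOn (hQint.mono interior_subset)
    (f := fun x => ⟪v, x⟫_ℝ) (by fun_prop)
  obtain ⟨x₀, hx₀, hvx₀⟩ := hminmem
  have hfin : ∀ P : EuclideanSpace ℝ (Fin n) → Prop, volume {x ∈ Q | P x} ≠ ⊤ := fun P =>
    ne_top_of_le_ne_top hQcompact.measure_ne_top (measure_mono (Set.sep_subset _ _))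
  have hlt : ∀ t, volume.real {x ∈ Q | ⟪v, x⟫_ℝ < t} =
      volume.real Q - volume.real {x ∈ Q | t ≤ ⟪v, x⟫_ℝ} := by
    intro t
    rw [← measureReal_sdiff (Set.sep_subset Q fun x => t ≤ ⟪v, x⟫_ℝ)
      (measurableSet_sep_le_inner hQcompact.measurableSet v t) hQcompact.measure_ne_top]
    congr 1
    ext x
    simp +contextual [not_le]
  refine tail_lower_bound (G := fun t => volume.real {x ∈ Q | t ≤ ⟪v, x⟫_ℝ} / volume.real Q)
    (M := ⟪v, y₀⟫_ℝ) hn hε ?_ hm ?_ ?_ ?_ ?_ ?_ ?_ ?_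
  · obtain ⟨y, hy, hyε⟩ := hmax
    exact hyε.trans (hy₀max hy)
  · intro s t hst
    simp only
    gcongr
    · exact hfin _
  · intro t
    positivity
  · have e : {x ∈ Q | -1 ≤ ⟪v, x⟫_ℝ} = Q := Set.sep_eq_self_iff_mem_true.2 hminle
    simp only [e, div_self hV.ne']
  · intro t ht
    have e : {x ∈ Q | t ≤ ⟪v, x⟫_ℝ} = ∅ :=
      Set.sep_eq_empty_iff_mem_false.2 fun x hx => not_le.2 ((hy₀max hx).trans_lt ht)
    simp [e]
  · intro t u _ ht hu huM
    have := measureReal_halfspace_brunn_minkowski hn hQcompact hQconvex hy₀ ht hu huM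
    simp only [Real.div_rpow measureReal_nonneg hV.le]
    rw [mul_div_assoc', mul_div_assoc', mul_div_assoc', ← add_div]
    gcongr
  · intro t s ht hts hs _
    have hone : ∀ t, 1 - volume.real {x ∈ Q | t ≤ ⟪v, x⟫_ℝ} / volume.real Q =
        volume.real {x ∈ Q | ⟪v, x⟫_ℝ < t} / volume.real Q := by
      intro t
      rw [hlt, sub_div, div_self hV.ne']
    simp only [hone]
    rcases ht.eq_or_lt with rfl | ht
    · simp only [add_neg_cancel, zero_div, ne_eq, hn, not_false_eq_true, zero_pow, zero_mul]
      positivity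
    · rw [mul_div_assoc']
      gcongr
      exact pow_mul_measureReal_lt_le hQcompact hQconvex hx₀ hvx₀ ht hts
  · rw [integral_div, integral_measureReal_halfspace hQcompact hminle, add_div, div_self hV.ne']
    rw [inner_smul_right, ← measureReal_def, inv_mul_eq_div, neg_div] at hcent
    linarith
end

section
/- Let Q ⊆ ℝⁿ be a compact convex body with nonempty interior and centroid c_Q = (∫_Q x dx)/Vol(Q). Let m ≥ 1 and v ∈ ℝⁿ be such that ⟨v,c_Q⟩ ≥ −m/(n+1), min_{x∈Q}⟨v,x⟩ ≤ −1, and max_{y∈Q}⟨v,y⟩ ≥ 1. Then Vol(Q_v⁺)/Vol(Q) ≥ 1/(2e^m). -/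
open MeasureTheory InnerProductSpace

open scoped ENNReal Pointwise

/-- A measure `μ` satisfies the Prékopa–Leindler inequality. -/
def PrekopaLeindler {E : Type*} [AddCommGroup E] [Module ℝ E] [MeasurableSpace E]
    (μ : Measure E) : Prop :=
  ∀ a b : ℝ, 0 < a → 0 < b → a + b = 1 → ∀ f g h : E → ℝ≥0∞,
    Measurable f → Measurable g → Measurable h →
    (∀ x y, f x ^ a * g y ^ b ≤ h (a • x + b • y)) →
    (∫⁻ x, f x ∂μ) ^ a * (∫⁻ x, g x ∂μ) ^ b ≤ ∫⁻ x, h x ∂μ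

theorem volume_add_le_of_isCompact_s10 {A B : Set ℝ} (hA : IsCompact A) (hB : IsCompact B)
    (hA0 : A.Nonempty) (hB0 : B.Nonempty) : volume A + volume B ≤ volume (A + B) := by
  obtain ⟨x, hx, hxA⟩ := hA.exists_isGreatest hA0
  obtain ⟨y, hy, hyB⟩ := hB.exists_isLeast hB0
  have h1 : (fun z => y + z) '' A ∪ (fun z => x + z) '' B ⊆ A + B := by
    rintro _ (⟨z, hz, rfl⟩ | ⟨z, hz, rfl⟩)
    · exact ⟨z, hz, y, hy, add_comm _ _⟩
    · exact ⟨x, hx, z, hz, rfl⟩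
  have h2 : AEDisjoint volume ((fun z => y + z) '' A) ((fun z => x + z) '' B) := by
    refine measure_mono_null (t := {x + y}) ?_ (by simp)
    rintro _ ⟨⟨z, hz, rfl⟩, ⟨w, hw, hzw⟩⟩
    have e1 := hxA hz
    have e2 := hyB hw
    simp only at hzw
    simp only [Set.mem_singleton_iff]
    linarith
  calc volume A + volume B
      = volume ((fun z => y + z) '' A) + volume ((fun z => x + z) '' B) := by
        simp [Set.image_add_left]
    _ = volume ((fun z => y + z) '' A ∪ (fun z => x + z) '' B) :=
        (measure_union₀ (hB.image (by fun_prop)).measurableSet.nullMeasurableSet h2).symm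
    _ ≤ _ := measure_mono h1

theorem volume_add_volume_le_of_add_subset {A B C : Set ℝ} (hA : MeasurableSet A)
    (hB : MeasurableSet B) (hA0 : A.Nonempty) (hB0 : B.Nonempty) (hC : A + B ⊆ C) :
    volume A + volume B ≤ volume C := by
  obtain ⟨x, hx⟩ := hA0
  obtain ⟨y, hy⟩ := hB0
  rw [hA.measure_eq_iSup_isCompact, hB.measure_eq_iSup_isCompact]
  simp only [iSup_and']
  refine ENNReal.biSup_add_biSup_le' ⟨∅, by simp⟩ ⟨∅, by simp⟩ fun K hK L hL => ?_
  calc volume K + volume L ≤ volume (insert x K) + volume (insert y L) := by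
        gcongr <;> exact Set.subset_insert _ _
    _ ≤ volume (insert x K + insert y L) := volume_add_le_of_isCompact_s10 (hK.2.insert x)
        (hL.2.insert y) (Set.insert_nonempty _ _) (Set.insert_nonempty _ _)
    _ ≤ volume C := measure_mono ((Set.add_subset_add (Set.insert_subset hx hK.1)
        (Set.insert_subset hy hL.1)).trans hC)

theorem ENNReal.rpow_mul_rpow_le_add_s10 {a b : ℝ} (ha : 0 < a) (hb : 0 < b) (hab : a + b = 1)
    (x y : ℝ≥0∞) : x ^ a * y ^ b ≤ ENNReal.ofReal a * x + ENNReal.ofReal b * y := by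
  have ha' : ENNReal.ofReal a ≠ 0 := by simpa using ha
  have hb' : ENNReal.ofReal b ≠ 0 := by simpa using hb
  rcases eq_or_ne x ⊤ with rfl | hx
  · simp [ENNReal.mul_top ha']
  rcases eq_or_ne y ⊤ with rfl | hy
  · simp [ENNReal.mul_top hb']
  lift x to NNReal using hx
  lift y to NNReal using hy
  lift a to NNReal using ha.le
  lift b to NNReal using hb.le
  have := NNReal.geom_mean_le_arith_mean2_weighted a b x y (by exact_mod_cast hab)
  rw [← ENNReal.coe_rpow_of_nonneg x a.coe_nonneg, ← ENNReal.coe_rpow_of_nonneg y b.coe_nonneg]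
  simp only [ENNReal.ofReal_coe_nnreal]
  exact_mod_cast this

theorem lintegral_eq_lintegral_lt_of_le_one {f : ℝ → ℝ≥0∞} (hf : Measurable f)
    (hf1 : ∀ x, f x ≤ 1) :
    ∫⁻ x, f x = ∫⁻ t in Set.Ioi (0 : ℝ), volume {x | ENNReal.ofReal t < f x} := by
  have hfin : ∀ x, f x ≠ ⊤ := fun x => ne_top_of_le_ne_top ENNReal.one_ne_top (hf1 x)
  have := lintegral_eq_lintegral_meas_lt volume (f := fun x => (f x).toReal)
    (Filter.Eventually.of_forall fun x => ENNReal.toReal_nonneg) hf.ennreal_toReal.aemeasurable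
  simp only [ENNReal.ofReal_toReal (hfin _)] at this
  rw [this]
  refine setLIntegral_congr_fun measurableSet_Ioi fun t ht => ?_
  refine congrArg _ ?_
  ext x
  simp only [Set.mem_ofPred_eq]
  rw [ENNReal.ofReal_lt_iff_lt_toReal (le_of_lt ht) (hfin x)]

theorem lintegral_add_le_of_sup_eq_one {a b : ℝ} (ha : 0 < a) (hb : 0 < b) (hab : a + b = 1)
    {f g h : ℝ → ℝ≥0∞} (hf : Measurable f) (hg : Measurable g) (hh : Measurable h)
    (hf1 : ∀ x, f x ≤ 1) (hg1 : ∀ x, g x ≤ 1)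
    (hf2 : ∀ t < 1, ∃ x, t < f x) (hg2 : ∀ t < 1, ∃ x, t < g x)
    (H : ∀ x y, f x ^ a * g y ^ b ≤ h (a • x + b • y)) :
    ENNReal.ofReal a * (∫⁻ x, f x) + ENNReal.ofReal b * (∫⁻ x, g x) ≤ ∫⁻ x, h x := by
  have hm : ∀ F : ℝ → ℝ≥0∞, Measurable fun t : ℝ => volume {x | ENNReal.ofReal t < F x} := by
    intro F
    refine Antitone.measurable fun s t hst => measure_mono fun x hx => ?_
    exact lt_of_le_of_lt (ENNReal.ofReal_le_ofReal hst) hx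
  calc _ = ∫⁻ t in Set.Ioi (0 : ℝ), (ENNReal.ofReal a * volume {x | ENNReal.ofReal t < f x} +
          ENNReal.ofReal b * volume {x | ENNReal.ofReal t < g x}) := by
        rw [lintegral_eq_lintegral_lt_of_le_one hf hf1, lintegral_eq_lintegral_lt_of_le_one hg hg1,
          lintegral_add_left ((hm f).const_mul _), lintegral_const_mul _ (hm f),
          lintegral_const_mul _ (hm g)]
    _ ≤ ∫⁻ t in Set.Ioi (0 : ℝ), volume {x | ENNReal.ofReal t < min (h x) 1} := by
        refine setLIntegral_mono (hm _) fun t ht => ?_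
        rcases lt_or_ge t 1 with ht1 | ht1
        · have hT : ENNReal.ofReal t < 1 := by
            rw [← ENNReal.ofReal_one]
            exact (ENNReal.ofReal_lt_ofReal_iff one_pos).2 ht1
          have key : ∀ (c : ℝ) (A : Set ℝ), 0 < c →
              volume (c • A) = ENNReal.ofReal c * volume A := by
            intro c A hc
            simp [Measure.addHaar_smul, abs_of_pos hc]
          rw [← key a _ ha, ← key b _ hb]
          refine volume_add_volume_le_of_add_subset
            ((measurableSet_lt measurable_const hf).const_smul₀ _)
            ((measurableSet_lt measurable_const hg).const_smul₀ _)
            (Set.Nonempty.smul_set (hf2 _ hT)) (Set.Nonempty.smul_set (hg2 _ hT)) ?_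
          rintro _ ⟨_, ⟨x, hx, rfl⟩, _, ⟨y, hy, rfl⟩, rfl⟩
          refine lt_min (lt_of_lt_of_le ?_ (H x y)) hT
          have hT0 : ENNReal.ofReal t ≠ 0 := by simpa using ht
          calc ENNReal.ofReal t = ENNReal.ofReal t ^ a * ENNReal.ofReal t ^ b := by
                rw [← ENNReal.rpow_add _ _ hT0 ENNReal.ofReal_ne_top, hab, ENNReal.rpow_one]
            _ < _ := ENNReal.mul_lt_mul (ENNReal.rpow_lt_rpow hx ha) (ENNReal.rpow_lt_rpow hy hb)
        · have hT : (1 : ℝ≥0∞) ≤ ENNReal.ofReal t := by simpa using ht1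
          have e : ∀ F : ℝ → ℝ≥0∞, (∀ x, F x ≤ 1) → {x | ENNReal.ofReal t < F x} = ∅ := by
            intro F hF
            ext x
            simpa using (hF x).trans hT
          simp [e f hf1, e g hg1]
    _ = ∫⁻ x, min (h x) 1 :=
        (lintegral_eq_lintegral_lt_of_le_one (hh.min measurable_const)
          fun x => min_le_right _ _).symm
    _ ≤ _ := lintegral_mono fun x => min_le_left _ _

theorem lintegral_rpow_mul_le_of_bounded {a b : ℝ} (ha : 0 < a) (hb : 0 < b) (hab : a + b = 1)
    {f g h : ℝ → ℝ≥0∞} (hf : Measurable f) (hg : Measurable g) (hh : Measurable h)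
    {K : ℝ≥0∞} (hK : K ≠ ⊤) (hf1 : ∀ x, f x ≤ K) (hg1 : ∀ x, g x ≤ K)
    (H : ∀ x y, f x ^ a * g y ^ b ≤ h (a • x + b • y)) :
    (∫⁻ x, f x) ^ a * (∫⁻ x, g x) ^ b ≤ ∫⁻ x, h x := by
  obtain ⟨M, hM⟩ : ∃ M, M = ⨆ x, f x := ⟨_, rfl⟩
  obtain ⟨N, hN⟩ : ∃ N, N = ⨆ x, g x := ⟨_, rfl⟩
  have hMt : M ≠ ⊤ := ne_top_of_le_ne_top hK (hM ▸ iSup_le hf1)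
  have hNt : N ≠ ⊤ := ne_top_of_le_ne_top hK (hN ▸ iSup_le hg1)
  rcases eq_or_ne M 0 with hM0 | hM0
  · have : ∀ x, f x = 0 := by simpa [hM0] using hM.symm
    simp [this, ha]
  rcases eq_or_ne N 0 with hN0 | hN0
  · have : ∀ x, g x = 0 := by simpa [hN0] using hN.symm
    simp [this, hb]
  have norm : ∀ (F : ℝ → ℝ≥0∞) (L : ℝ≥0∞), L = ⨆ x, F x → L ≠ 0 → L ≠ ⊤ →
      (∀ x, L⁻¹ * F x ≤ 1) ∧ ∀ t < 1, ∃ x, t < L⁻¹ * F x := by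
    intro F L hL h0 ht
    refine ⟨fun x => ?_, fun t ht1 => ?_⟩
    · rw [← ENNReal.inv_mul_cancel h0 ht]
      gcongr
      rw [hL]
      exact le_iSup F x
    · have : t * L < ⨆ x, F x := by
        rw [← hL]
        simpa using (ENNReal.mul_lt_mul_iff_left h0 ht).2 ht1
      obtain ⟨x, hx⟩ := lt_iSup_iff.1 this
      refine ⟨x, ?_⟩
      rw [mul_comm, ← div_eq_mul_inv]
      exact (ENNReal.lt_div_iff_mul_lt (Or.inl h0) (Or.inl ht)).2 hx
  obtain ⟨f1, f2⟩ := norm f M hM hM0 hMt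
  obtain ⟨g1, g2⟩ := norm g N hN hN0 hNt
  have hP0 : M ^ a * N ^ b ≠ 0 := by
    simp [hM0, hN0, hMt, hNt]
  have hPt : M ^ a * N ^ b ≠ ⊤ := ENNReal.mul_ne_top (ENNReal.rpow_ne_top_of_nonneg ha.le hMt)
    (ENNReal.rpow_ne_top_of_nonneg hb.le hNt)
  have hinv : (M⁻¹) ^ a * (N⁻¹) ^ b = (M ^ a * N ^ b)⁻¹ := by
    rw [ENNReal.mul_inv (Or.inr (ENNReal.rpow_ne_top_of_nonneg hb.le hNt))
      (Or.inl (ENNReal.rpow_ne_top_of_nonneg ha.le hMt)), ENNReal.inv_rpow, ENNReal.inv_rpow]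
  have key := lintegral_add_le_of_sup_eq_one ha hb hab (hf.const_mul M⁻¹) (hg.const_mul N⁻¹)
    (hh.const_mul (M ^ a * N ^ b)⁻¹) f1 g1 f2 g2 (fun x y => by
      rw [ENNReal.mul_rpow_of_nonneg _ _ ha.le, ENNReal.mul_rpow_of_nonneg _ _ hb.le,
        mul_mul_mul_comm, hinv]
      gcongr
      exact H x y)
  have key2 := (ENNReal.rpow_mul_rpow_le_add_s10 ha hb hab _ _).trans key
  rw [lintegral_const_mul _ hf, lintegral_const_mul _ hg, lintegral_const_mul _ hh,
    ENNReal.mul_rpow_of_nonneg _ _ ha.le, ENNReal.mul_rpow_of_nonneg _ _ hb.le,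
    mul_mul_mul_comm, hinv] at key2
  exact (ENNReal.mul_le_mul_iff_right (ENNReal.inv_ne_zero.2 hPt) (ENNReal.inv_ne_top.2 hP0)).1 key2

theorem prekopaLeindler_real : PrekopaLeindler (volume : Measure ℝ) := by
  intro a b ha hb hab f g h hf hg hh H
  have trunc : ∀ F : ℝ → ℝ≥0∞, Measurable F →
      Filter.Tendsto (fun k : ℕ => ∫⁻ x, min (F x) k) Filter.atTop (nhds (∫⁻ x, F x)) := by
    intro F hF
    refine lintegral_tendsto_of_tendsto_of_monotone
      (fun k => (hF.min measurable_const).aemeasurable)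
      (Filter.Eventually.of_forall fun x i j hij => ?_) (Filter.Eventually.of_forall fun x => ?_)
    · exact min_le_min_left _ (by exact_mod_cast hij)
    · simpa using (tendsto_const_nhds (x := F x)).min ENNReal.tendsto_nat_nhds_top
  rcases eq_or_ne (∫⁻ x, f x) 0 with h0 | hf0
  · simp [h0, ha]
  rcases eq_or_ne (∫⁻ x, g x) 0 with h0 | hg0
  · simp [h0, hb]
  have lim := ENNReal.Tendsto.mul
    ((ENNReal.continuous_rpow_const (y := a)).continuousAt.tendsto.comp (trunc f hf))
    (Or.inl (by simp [hf0, ha, ha.le]))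
    ((ENNReal.continuous_rpow_const (y := b)).continuousAt.tendsto.comp (trunc g hg))
    (Or.inl (by simp [hg0, hb, hb.le]))
  refine le_of_tendsto' lim fun k => ?_
  refine lintegral_rpow_mul_le_of_bounded ha hb hab (hf.min measurable_const)
    (hg.min measurable_const) hh (ENNReal.natCast_ne_top k) (fun x => min_le_right _ _)
    (fun x => min_le_right _ _) fun x y => le_trans ?_ (H x y)
  gcongr <;> exact min_le_left _ _

theorem PrekopaLeindler.prod {E F : Type*} [AddCommGroup E] [Module ℝ E] [MeasurableSpace E]
    [AddCommGroup F] [Module ℝ F] [MeasurableSpace F] {μ : Measure E} {ν : Measure F}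
    [SFinite ν] (hμ : PrekopaLeindler μ) (hν : PrekopaLeindler ν) :
    PrekopaLeindler (μ.prod ν) := by
  intro a b ha hb hab f g h hf hg hh H
  rw [lintegral_prod _ hf.aemeasurable, lintegral_prod _ hg.aemeasurable,
    lintegral_prod _ hh.aemeasurable]
  refine hμ a b ha hb hab _ _ _ hf.lintegral_prod_right' hg.lintegral_prod_right'
    hh.lintegral_prod_right' fun x y => ?_
  exact hν a b ha hb hab _ _ _ (hf.comp measurable_prodMk_left) (hg.comp measurable_prodMk_left)
    (hh.comp measurable_prodMk_left) fun z w => H (x, z) (y, w)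

theorem PrekopaLeindler.of_measurePreserving {E F : Type*} [AddCommGroup E] [Module ℝ E]
    [MeasurableSpace E] [AddCommGroup F] [Module ℝ F] [MeasurableSpace F] {μ : Measure E}
    {ν : Measure F} (hμ : PrekopaLeindler μ) (e : E →ₗ[ℝ] F) (he : MeasurePreserving e μ ν) :
    PrekopaLeindler ν := by
  intro a b ha hb hab f g h hf hg hh H
  rw [← he.lintegral_comp hf, ← he.lintegral_comp hg, ← he.lintegral_comp hh]
  refine hμ a b ha hb hab _ _ _ (hf.comp he.measurable) (hg.comp he.measurable)
    (hh.comp he.measurable) fun x y => ?_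
  simpa using H (e x) (e y)

theorem prekopaLeindler_pi (n : ℕ) : PrekopaLeindler (volume : Measure (Fin n → ℝ)) := by
  induction n with
  | zero =>
    intro a b ha hb hab f g h hf hg hh H
    rw [Measure.volume_pi_eq_dirac 0]
    simpa using H 0 0
  | succ n ih =>
    refine (prekopaLeindler_real.prod ih).of_measurePreserving
      (Fin.consLinearEquiv ℝ (fun _ : Fin (n + 1) => ℝ)).toLinearMap ?_
    have := (volume_preserving_piFinSuccAbove (fun _ : Fin (n + 1) => ℝ) 0).symm
    have e : ⇑(Fin.consLinearEquiv ℝ (fun _ : Fin (n + 1) => ℝ)).toLinearMap =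
        ⇑(MeasurableEquiv.piFinSuccAbove (fun _ : Fin (n + 1) => ℝ) 0).symm := by
      ext p i
      simp [MeasurableEquiv.piFinSuccAbove, Fin.consEquiv]
    rw [e]
    exact this

theorem prekopaLeindler_euclideanSpace (n : ℕ) :
    PrekopaLeindler (volume : Measure (EuclideanSpace ℝ (Fin n))) :=
  (prekopaLeindler_pi n).of_measurePreserving
    (WithLp.linearEquiv 2 ℝ (Fin n → ℝ)).symm.toLinearMap (PiLp.volume_preserving_toLp (Fin n))

theorem PrekopaLeindler.measure_rpow_mul_le {E : Type*} [AddCommGroup E] [Module ℝ E]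
    [MeasurableSpace E] {μ : Measure E} (hμ : PrekopaLeindler μ) {a b : ℝ} (ha : 0 < a)
    (hb : 0 < b) (hab : a + b = 1) {A B C : Set E} (hA : MeasurableSet A) (hB : MeasurableSet B)
    (hC : MeasurableSet C) (H : ∀ x ∈ A, ∀ y ∈ B, a • x + b • y ∈ C) :
    μ A ^ a * μ B ^ b ≤ μ C := by
  have := hμ a b ha hb hab (A.indicator 1) (B.indicator 1) (C.indicator 1)
    (measurable_one.indicator hA) (measurable_one.indicator hB) (measurable_one.indicator hC)
    fun x y => by
      by_cases hx : x ∈ A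
      · by_cases hy : y ∈ B
        · simp [hx, hy, H x hx y hy]
        · simp [hy, hb]
      · simp [hx, ha]
  simpa [lintegral_indicator_one, hA, hB, hC] using this

/-- A log-concave nonincreasing function `g` which satisfies the cone condition with apex `1`
lies below an exponential of rate at most `n` that touches it at `0`. -/
theorem exists_exponential_majorant {g : ℝ → ℝ} (n : ℕ) (hanti : Antitone g) (hpos : 0 < g 0)
    (hlc : ∀ s t a b : ℝ, 0 < a → 0 < b → a + b = 1 →
      g s ^ a * g t ^ b ≤ g (a * s + b * t))
    (hcone : ∀ ρ : ℝ, 0 < ρ → ρ ≤ 1 → ρ ^ n * g 0 ≤ g (1 - ρ)) (hnn : ∀ t, 0 ≤ g t) :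
    ∃ β : ℝ, 0 ≤ β ∧ β ≤ n ∧ ∀ t, g t ≤ g 0 * Real.exp (-(β * t)) := by
  have hleft : ∀ t < 0, 0 < g t := fun t ht => hpos.trans_le (hanti ht.le)
  have slope : ∀ t < 0, ∀ u > 0, 0 < g u →
      Real.log (g t / g 0) / (-t) ≤ Real.log (g 0 / g u) / u := by
    intro t ht u hu hgu
    have hut : 0 < u - t := by linarith
    have h := hlc t u (u / (u - t)) (-t / (u - t)) (by positivity)
      (div_pos (by linarith) hut) (by field_simp; ring)
    have e : u / (u - t) * t + -t / (u - t) * u = 0 := by field_simp; ring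
    rw [e] at h
    have hgt := hleft t ht
    have h' := Real.log_le_log (by positivity) h
    rw [Real.log_mul (by positivity) (by positivity), Real.log_rpow hgt, Real.log_rpow hgu] at h'
    have h'' : u * Real.log (g t) + -t * Real.log (g u) ≤ (u - t) * Real.log (g 0) := by
      have := mul_le_mul_of_nonneg_left h' hut.le
      have e2 : (u - t) * (u / (u - t) * Real.log (g t) + -t / (u - t) * Real.log (g u)) =
        u * Real.log (g t) + -t * Real.log (g u) := by field_simp
      linarith
    rw [div_le_div_iff₀ (by linarith) hu, Real.log_div hgt.ne' hpos.ne',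
      Real.log_div hpos.ne' hgu.ne']
    linarith
  have bound : ∀ t < 0, Real.log (g t / g 0) / (-t) ≤ n := by
    intro t ht
    have : ∀ r : ℝ, 0 < r → r < 1 → r * (Real.log (g t / g 0) / (-t)) ≤ n := by
      intro r hr hr1
      have hc := hcone r hr hr1.le
      have hgu : 0 < g (1 - r) := lt_of_lt_of_le (by positivity) hc
      refine (mul_le_mul_of_nonneg_left (slope t ht (1 - r) (by linarith) hgu) hr.le).trans ?_
      have h1 : Real.log (g 0 / g (1 - r)) ≤ n * (1 / r - 1) := by
        calc Real.log (g 0 / g (1 - r)) ≤ Real.log ((1 / r) ^ n) := by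
              refine Real.log_le_log (by positivity) ?_
              rw [div_le_iff₀ hgu, one_div, inv_pow, inv_mul_eq_div, le_div_iff₀ (by positivity)]
              linarith
          _ = n * Real.log (1 / r) := by rw [Real.log_pow]
          _ ≤ _ := by
              gcongr
              exact Real.log_le_sub_one_of_pos (by positivity)
      have h2 : 0 < 1 - r := by linarith
      calc r * (Real.log (g 0 / g (1 - r)) / (1 - r)) ≤ r * ((n * (1 / r - 1)) / (1 - r)) := by
            gcongr
        _ = n := by field_simp
    refine le_of_tendsto (f := fun r : ℝ => r * (Real.log (g t / g 0) / (-t)))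
      (x := nhdsWithin 1 (Set.Iio 1)) ?_ ?_
    · have : ContinuousWithinAt (fun r : ℝ => r * (Real.log (g t / g 0) / (-t))) (Set.Iio 1) 1 := by
        fun_prop
      simpa [ContinuousWithinAt] using this
    · filter_upwards [Ioo_mem_nhdsLT (zero_lt_one (α := ℝ))] with r hr using this r hr.1 hr.2
  obtain ⟨S, hS⟩ : ∃ S, S = (fun t => Real.log (g t / g 0) / (-t)) '' Set.Iio 0 := ⟨_, rfl⟩
  have hSb : BddAbove S := ⟨n, by rw [hS]; rintro _ ⟨t, ht, rfl⟩; exact bound t ht⟩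
  have hSm : ∀ t < 0, Real.log (g t / g 0) / (-t) ≤ sSup S := fun t ht =>
    le_csSup hSb (by rw [hS]; exact ⟨t, ht, rfl⟩)
  have hSne : S.Nonempty := by rw [hS]; exact ⟨_, -1, by norm_num, rfl⟩
  refine ⟨sSup S, ?_, ?_, fun t => ?_⟩
  · refine le_trans ?_ (hSm (-1) (by norm_num))
    refine div_nonneg (Real.log_nonneg ?_) (by norm_num)
    rw [one_le_div hpos]
    exact hanti (by norm_num)
  · refine csSup_le hSne ?_
    rw [hS]; rintro _ ⟨t, ht, rfl⟩; exact bound t ht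
  · rcases lt_trichotomy t 0 with ht | rfl | ht
    · have h := hSm t ht
      rw [div_le_iff₀ (by linarith), Real.log_le_iff_le_exp (div_pos (hleft t ht) hpos),
        div_le_iff₀ hpos] at h
      rw [mul_comm, ← mul_neg]
      exact h
    · simp
    · rcases (hnn t).eq_or_lt with h0 | h0
      · rw [← h0]; positivity
      · have h : sSup S ≤ Real.log (g 0 / g t) / t := by
          refine csSup_le hSne ?_
          rw [hS]; rintro _ ⟨s, hs, rfl⟩; exact slope s hs t ht h0
        rw [le_div_iff₀ ht, Real.le_log_iff_exp_le (by positivity), le_div_iff₀ h0] at h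
        rw [Real.exp_neg, ← div_eq_mul_inv, le_div_iff₀ (Real.exp_pos _)]
        linarith

theorem half_exp_neg_le {b m : ℝ} (hb0 : 0 < b) (hb1 : b ≤ 1) (hm : 1 ≤ m) :
    1 / (2 * Real.exp m) ≤ Real.exp (-(1 + b * (m - 1))) / (1 + b) := by
  have h : Real.exp (1 + b * (m - 1)) ≤ Real.exp m := Real.exp_le_exp.2 (by nlinarith)
  rw [Real.exp_neg, inv_eq_one_div, div_div]
  refine one_div_le_one_div_of_le (by positivity) ?_
  rw [mul_comm 2]
  exact mul_le_mul h (by linarith) (by linarith) (Real.exp_pos _).le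

theorem tail_bound_of_mean_estimate {n : ℕ} {m β p : ℝ} (hm : 1 ≤ m) (hp0 : 0 ≤ p) (hβ : 0 < β)
    (hβn : β ≤ n) (H : ∀ θ : ℝ, 0 ≤ θ → p * Real.exp (β * θ) ≤ 1 →
      θ - p * Real.exp (β * θ) / β + (1 - p * Real.exp (β * θ)) * (1 - θ) / (n + 1)
        ≤ m / (n + 1)) :
    1 / (2 * Real.exp m) ≤ p := by
  have hn : (0 : ℝ) < n := hβ.trans_le hβn
  obtain ⟨θ, hθ⟩ : ∃ θ, θ = (m - 1) / n + 1 / β := ⟨_, rfl⟩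
  have hθ0 : 0 ≤ θ := by rw [hθ]; have : 0 ≤ m - 1 := by linarith
                         positivity
  obtain ⟨R, hR⟩ : ∃ R, R = p * Real.exp (β * θ) := ⟨_, rfl⟩
  have key : n / (n + β) ≤ R := by
    rcases le_or_gt R 1 with h1 | h1
    · have h := H θ hθ0 (hR ▸ h1)
      rw [← hR] at h
      have hnθ : n * θ = m - 1 + n / β := by rw [hθ]; field_simp
      have h2 : (n + 1) * θ - R * ((n + 1) / β) + (1 - R) * (1 - θ) ≤ m := by
        have := mul_le_mul_of_nonneg_right h (by positivity : (0 : ℝ) ≤ n + 1)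
        field_simp at this ⊢
        linarith
      have h3 : n / β ≤ R * (1 - θ + (n + 1) / β) := by linarith
      have h4 : (n : ℝ) ≤ R * (β * (1 - θ) + n + 1) := by
        have := mul_le_mul_of_nonneg_left h3 hβ.le
        have e1 : β * (n / β) = n := by field_simp
        have e2 : β * (R * (1 - θ + (n + 1) / β)) = R * (β * (1 - θ) + n + 1) := by
          field_simp; ring
        linarith
      have h5 : 1 ≤ β * θ := by
        have : β * θ = β * ((m - 1) / n) + 1 := by rw [hθ]; field_simp
        have h6 : 0 ≤ β * ((m - 1) / n) := by
          have : 0 ≤ m - 1 := by linarith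
          positivity
        linarith
      have hRpos : 0 ≤ R := by rw [hR]; positivity
      rw [div_le_iff₀ (by linarith)]
      nlinarith
    · refine le_trans ?_ h1.le
      rw [div_le_one (by linarith)]
      linarith
  have hp : p = R * Real.exp (-(β * θ)) := by
    rw [hR, mul_assoc, ← Real.exp_add]; simp
  have := half_exp_neg_le (b := β / n) (by positivity) (by rwa [div_le_one hn]) hm
  refine this.trans ?_
  rw [hp]
  have e : β * θ = 1 + β / n * (m - 1) := by rw [hθ]; field_simp; ring
  rw [← e, div_eq_mul_inv, mul_comm]
  have e2 : (1 + β / n)⁻¹ = n / (n + β) := by field_simp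
  rw [e2]
  gcongr

theorem integral_le_of_tail_bounds {Ω : Type*} [MeasurableSpace Ω] {μ : Measure Ω}
    [IsProbabilityMeasure μ] {X : Ω → ℝ} (hX : Measurable X) (hXi : Integrable X μ) {n : ℕ}
    {p β θ : ℝ} (hβ : 0 < β) (hp : 0 ≤ p)
    (hR : p * Real.exp (β * θ) ≤ 1)
    (hexp : ∀ t, μ.real {ω | t ≤ X ω} ≤ p * Real.exp (-(β * t)))
    (hcone : ∀ ρ : ℝ, 0 < ρ → ρ ≤ 1 → ∀ s,
      ρ ^ n * μ.real {ω | X ω < s} ≤ μ.real {ω | X ω < ρ * s - (1 - ρ)}) :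
    ∫ ω, X ω ∂μ ≤ -(θ - p * Real.exp (β * θ) / β +
      (1 - p * Real.exp (β * θ)) * (1 - θ) / (n + 1)) := by
  obtain ⟨R, hRdef⟩ : ∃ R, R = p * Real.exp (β * θ) := ⟨_, rfl⟩
  rw [← hRdef] at hR ⊢
  have hR0 : 0 ≤ R := by rw [hRdef]; positivity
  have hYi : Integrable (fun ω => X ω + θ) μ := hXi.add (integrable_const θ)
  have hpos : ∫ ω, max (X ω + θ) 0 ∂μ ≤ R / β := by
    rw [integral_eq_lintegral_of_nonneg_ae (f := fun ω => max (X ω + θ) 0)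
      (Filter.Eventually.of_forall fun ω => le_max_right _ _)
      hYi.pos_part.aestronglyMeasurable]
    refine ENNReal.toReal_le_of_le_ofReal (by positivity) ?_
    rw [lintegral_eq_lintegral_meas_le μ (f := fun ω => max (X ω + θ) 0)
      (Filter.Eventually.of_forall fun ω => le_max_right _ _) (by fun_prop)]
    calc _ ≤ ∫⁻ t in Set.Ioi (0 : ℝ), ENNReal.ofReal (R * Real.exp (-β * t)) := by
          refine setLIntegral_mono (by fun_prop) fun t ht => ?_
          have e : {a | t ≤ max (X a + θ) 0} = {a | t - θ ≤ X a} := by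
            ext a
            have : ¬ t ≤ 0 := not_le.2 ht
            simp [this]
          rw [e, ← ofReal_measureReal]
          refine ENNReal.ofReal_le_ofReal ((hexp _).trans_eq ?_)
          rw [hRdef, mul_assoc, ← Real.exp_add]
          ring_nf
      _ = ENNReal.ofReal (∫ t in Set.Ioi (0 : ℝ), R * Real.exp (-β * t)) := by
          rw [ofReal_integral_eq_lintegral_ofReal]
          · exact ((integrableOn_exp_mul_Ioi (by linarith) 0)).const_mul R
          · exact Filter.Eventually.of_forall fun t => by positivity
      _ ≤ _ := by
          rw [integral_const_mul, integral_exp_mul_Ioi (by linarith)]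
          simp [div_eq_mul_inv]
  have hneg : (1 - R) * (1 - θ) / (n + 1) ≤ ∫ ω, max (-(X ω + θ)) 0 ∂μ := by
    rcases le_or_gt 1 θ with h1 | h1
    · refine le_trans ?_ (integral_nonneg fun ω => le_max_right _ _)
      refine div_nonpos_of_nonpos_of_nonneg ?_ (by positivity)
      nlinarith
    have h1' : 0 < 1 - θ := by linarith
    have hlt : 1 - R ≤ μ.real {ω | X ω < -θ} := by
      have h := hexp (-θ)
      have e : {ω | X ω < -θ} = {ω | -θ ≤ X ω}ᶜ := by ext; simp
      rw [e, measureReal_compl (measurableSet_le measurable_const hX), probReal_univ]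
      have e2 : -(β * -θ) = β * θ := by ring
      rw [e2, ← hRdef] at h
      linarith
    rw [integral_eq_lintegral_of_nonneg_ae (f := fun ω => max (-(X ω + θ)) 0)
      (Filter.Eventually.of_forall fun ω => le_max_right _ _)
      hYi.neg_part.aestronglyMeasurable]
    have hfin : ∫⁻ ω, ENNReal.ofReal (max (-(X ω + θ)) 0) ∂μ ≠ ⊤ :=
      (hYi.neg.pos_part).lintegral_lt_top.ne
    refine (ENNReal.ofReal_le_iff_le_toReal hfin).1 ?_
    rw [lintegral_eq_lintegral_meas_lt μ (f := fun ω => max (-(X ω + θ)) 0)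
      (Filter.Eventually.of_forall fun ω => le_max_right _ _) (by fun_prop)]
    have hint : ∫ t in (0 : ℝ)..(1 - θ), (1 - R) * ((1 - θ - t) / (1 - θ)) ^ n =
        (1 - R) * (1 - θ) / (n + 1) := by
      rw [intervalIntegral.integral_const_mul]
      simp_rw [div_pow]
      rw [intervalIntegral.integral_div, intervalIntegral.integral_comp_sub_left (fun x => x ^ n)]
      simp
      field_simp
      ring
    rw [← hint, intervalIntegral.integral_of_le h1'.le, integral_Ioc_eq_integral_Ioo,
      ofReal_integral_eq_lintegral_ofReal]
    rotate_left
    · refine (ContinuousOn.integrableOn_compact (K := Set.Icc 0 (1 - θ)) isCompact_Icc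
        (by fun_prop)).mono_set Set.Ioo_subset_Icc_self
    · filter_upwards [ae_restrict_mem measurableSet_Ioo] with t ht
      have h2 : 0 ≤ 1 - θ - t := by linarith [ht.2]
      have h3 : 0 ≤ 1 - R := by linarith
      simp only [Pi.zero_apply]
      positivity
    refine le_trans ?_ (lintegral_mono_set (s := Set.Ioo 0 (1 - θ)) Set.Ioo_subset_Ioi_self)
    refine setLIntegral_mono' measurableSet_Ioo fun t ht => ?_
    have e : {a | t < max (-(X a + θ)) 0} = {a | X a < -θ - t} := by
      ext a
      have h2 : ¬ t < 0 := not_lt.2 ht.1.le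
      simp only [Set.mem_ofPred_eq, lt_max_iff, h2, or_false]
      constructor <;> intro <;> linarith
    rw [e, ← ofReal_measureReal]
    refine ENNReal.ofReal_le_ofReal ?_
    have h2 : 0 < 1 - θ - t := by linarith [ht.2]
    have h3 := hcone ((1 - θ - t) / (1 - θ)) (by positivity)
      ((div_le_one h1').2 (by linarith [ht.1])) (-θ)
    have e2 : (1 - θ - t) / (1 - θ) * -θ - (1 - (1 - θ - t) / (1 - θ)) = -θ - t := by
      field_simp
      ring
    rw [e2] at h3
    refine le_trans ?_ h3
    rw [mul_comm]
    gcongr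
  have hsplit : ∫ ω, (X ω + θ) ∂μ =
      ∫ ω, max (X ω + θ) 0 ∂μ - ∫ ω, max (-(X ω + θ)) 0 ∂μ := by
    rw [← integral_sub hYi.pos_part hYi.neg_part]
    refine integral_congr_ae (Filter.Eventually.of_forall fun ω => ?_)
    simp only
    rcases le_total 0 (X ω + θ) with h | h
    · rw [max_eq_left h, max_eq_right (by linarith)]; ring
    · rw [max_eq_right h, max_eq_left (by linarith)]; ring
  rw [integral_add hXi (integrable_const θ)] at hsplit
  rw [integral_const, probReal_univ, one_smul] at hsplit
  linarith

theorem measureReal_nonneg_ge_of_log_concave {Ω : Type*} [MeasurableSpace Ω] {μ : Measure Ω}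
    [IsProbabilityMeasure μ] {X : Ω → ℝ} (hX : Measurable X) (hXi : Integrable X μ) {n : ℕ}
    {m M : ℝ} (hm : 1 ≤ m) (hM : ∀ᵐ ω ∂μ, |X ω| ≤ M)
    (hlc : ∀ s t a b : ℝ, 0 < a → 0 < b → a + b = 1 →
      μ.real {ω | s ≤ X ω} ^ a * μ.real {ω | t ≤ X ω} ^ b ≤ μ.real {ω | a * s + b * t ≤ X ω})
    (hcone_pos : ∀ ρ : ℝ, 0 < ρ → ρ ≤ 1 → ∀ s,
      ρ ^ n * μ.real {ω | s ≤ X ω} ≤ μ.real {ω | ρ * s + (1 - ρ) ≤ X ω})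
    (hcone_neg : ∀ ρ : ℝ, 0 < ρ → ρ ≤ 1 → ∀ s,
      ρ ^ n * μ.real {ω | X ω < s} ≤ μ.real {ω | X ω < ρ * s - (1 - ρ)})
    (hmean : -m / (n + 1) ≤ ∫ ω, X ω ∂μ) :
    1 / (2 * Real.exp m) ≤ μ.real {ω | 0 ≤ X ω} := by
  have hM0 : 0 ≤ M := by
    obtain ⟨ω, hω⟩ := hM.exists
    exact (abs_nonneg _).trans hω
  have hone : μ.real {ω | -M ≤ X ω} = 1 := by
    have h : ∀ᵐ ω ∂μ, ω ∈ {ω | -M ≤ X ω} := by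
      filter_upwards [hM] with ω hω using (abs_le.1 hω).1
    rw [measureReal_def, (mem_ae_iff_prob_eq_one (measurableSet_le measurable_const hX)).1 h,
      ENNReal.toReal_one]
  have hpos : 0 < μ.real {ω | 0 ≤ X ω} := by
    have h := hcone_pos (1 / (1 + M)) (by positivity) (by rw [div_le_one] <;> linarith) (-M)
    have e : 1 / (1 + M) * -M + (1 - 1 / (1 + M)) = 0 := by field_simp; ring
    rw [e, hone] at h
    exact lt_of_lt_of_le (by positivity) h
  obtain ⟨β, hβ0, hβn, hβ⟩ := exists_exponential_majorant (g := fun t => μ.real {ω | t ≤ X ω}) n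
    (fun s t hst => measureReal_mono fun ω hω => le_trans hst hω) hpos hlc
    (fun ρ h0 h1 => by simpa using hcone_pos ρ h0 h1 0) (fun t => measureReal_nonneg)
  rcases hβ0.eq_or_lt with rfl | hβ0
  · have h := hβ (-M)
    simp only [hone, zero_mul, neg_zero, Real.exp_zero, mul_one] at h
    refine le_trans ?_ h
    rw [div_le_one (by positivity)]
    have := Real.add_one_le_exp m
    linarith
  · refine tail_bound_of_mean_estimate hm hpos.le hβ0 hβn fun θ _ hR => ?_
    have h := integral_le_of_tail_bounds hX hXi hβ0 hpos.le hR hβ hcone_neg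
    rw [neg_div] at hmean
    linarith

theorem measure_inter_ge_of_homothety {E : Type*} [NormedAddCommGroup E] [NormedSpace ℝ E]
    [MeasurableSpace E] [BorelSpace E] [FiniteDimensional ℝ E] (μ : Measure E)
    [μ.IsAddHaarMeasure] {Q A B : Set E} (hQ : Convex ℝ Q) {y : E} (hy : y ∈ Q) {ρ : ℝ}
    (hρ0 : 0 ≤ ρ) (hρ1 : ρ ≤ 1) (H : ∀ x ∈ A, ρ • x + (1 - ρ) • y ∈ B) :
    ENNReal.ofReal (ρ ^ Module.finrank ℝ E) * μ (A ∩ Q) ≤ μ (B ∩ Q) := by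
  rw [← abs_of_nonneg (pow_nonneg hρ0 (Module.finrank ℝ E)),
    ← Measure.addHaar_image_homothety μ y ρ]
  refine measure_mono ?_
  rintro _ ⟨x, hx, rfl⟩
  have e : AffineMap.homothety y ρ x = ρ • x + (1 - ρ) • y := by
    simp only [AffineMap.homothety_apply, vsub_eq_sub, vadd_eq_add]
    module
  rw [e]
  exact ⟨H x hx.1, hQ hx.2 hy hρ0 (by linarith) (by ring)⟩

/-- Let `Q ⊆ ℝⁿ` be a compact convex body with nonempty interior and
centroid `c_Q = (∫_Q x dx)/Vol(Q)`.  Let `m ≥ 1` and `v` be such that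
`⟨v,c_Q⟩ ≥ −m/(n+1)`, `min_{x∈Q}⟨v,x⟩ ≤ −1` and `max_{y∈Q}⟨v,y⟩ ≥ 1`.  Then
`Vol(Q_v⁺)/Vol(Q) ≥ 1/(2e^m)`. -/
theorem stmt10 (n : ℕ) (Q : Set (EuclideanSpace ℝ (Fin n)))
    (hQcompact : IsCompact Q) (hQconvex : Convex ℝ Q)
    (hQint : (interior Q).Nonempty)
    (m : ℝ) (hm : 1 ≤ m) (v : EuclideanSpace ℝ (Fin n))
    (hcent : -m / ((n : ℝ) + 1) ≤
      ⟪v, ((volume Q).toReal)⁻¹ • ∫ x in Q, x⟫_ℝ)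
    (hmin : ∃ x ∈ Q, ⟪v, x⟫_ℝ ≤ -1) (hmax : ∃ y ∈ Q, 1 ≤ ⟪v, y⟫_ℝ) :
    1 / (2 * Real.exp m) ≤
      (volume {x ∈ Q | 0 ≤ ⟪v, x⟫_ℝ}).toReal / (volume Q).toReal := by
  have hV0 : volume Q ≠ 0 :=
    ((isOpen_interior.measure_pos volume hQint).trans_le (measure_mono interior_subset)).ne'
  have hVt : volume Q ≠ ⊤ := hQcompact.measure_ne_top
  obtain ⟨x₀, hx₀, hx₀v⟩ := hmin
  obtain ⟨y₀, hy₀, hy₀v⟩ := hmax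
  obtain ⟨μ, hμ⟩ : ∃ μ : Measure (EuclideanSpace ℝ (Fin n)),
    μ = (volume Q)⁻¹ • volume.restrict Q := ⟨_, rfl⟩
  have hV : 0 < (volume Q).toReal := ENNReal.toReal_pos hV0 hVt
  have hprob : IsProbabilityMeasure μ := ⟨by
    rw [hμ]; simp [ENNReal.inv_mul_cancel hV0 hVt]⟩
  have hcont : Continuous fun x => ⟪v, x⟫_ℝ := by fun_prop
  have hge : ∀ s : ℝ, MeasurableSet {x | s ≤ ⟪v, x⟫_ℝ} := fun s =>
    measurableSet_le measurable_const hcont.measurable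
  have hlt : ∀ s : ℝ, MeasurableSet {x | ⟪v, x⟫_ℝ < s} := fun s =>
    measurableSet_lt hcont.measurable measurable_const
  have hreal : ∀ A, MeasurableSet A →
      μ.real A = (volume Q).toReal⁻¹ * (volume (A ∩ Q)).toReal := by
    intro A hA
    simp [hμ, measureReal_def, Measure.restrict_apply hA]
  have hfin : ∀ A, volume (A ∩ Q) ≠ ⊤ := fun A =>
    ne_top_of_le_ne_top hVt (measure_mono Set.inter_subset_right)
  have hhom : ∀ A B, MeasurableSet A → MeasurableSet B → ∀ y ∈ Q, ∀ ρ : ℝ, 0 < ρ → ρ ≤ 1 →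
      (∀ x ∈ A, ρ • x + (1 - ρ) • y ∈ B) → ρ ^ n * μ.real A ≤ μ.real B := by
    intro A B hA hB y hy ρ h0 h1 H
    have h := measure_inter_ge_of_homothety volume hQconvex hy h0.le h1 H
    rw [finrank_euclideanSpace_fin] at h
    have h' := ENNReal.toReal_mono (hfin B) h
    rw [ENNReal.toReal_mul, ENNReal.toReal_ofReal (by positivity)] at h'
    rw [hreal A hA, hreal B hB, mul_left_comm]
    gcongr
  have hXi : IntegrableOn (fun x => ⟪v, x⟫_ℝ) Q :=
    hcont.continuousOn.integrableOn_compact hQcompact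
  obtain ⟨M, hM⟩ := hQcompact.exists_bound_of_continuousOn hcont.continuousOn
  have hmeas : {x ∈ Q | 0 ≤ ⟪v, x⟫_ℝ} = {x | 0 ≤ ⟪v, x⟫_ℝ} ∩ Q := by
    ext x
    exact and_comm
  rw [hmeas, div_eq_inv_mul _ (volume Q).toReal, ← hreal _ (hge 0)]
  refine measureReal_nonneg_ge_of_log_concave (n := n) (M := M) hcont.measurable ?_ hm ?_ ?_ ?_ ?_
    ?_
  · rw [hμ]
    exact Integrable.smul_measure hXi (ENNReal.inv_ne_top.2 hV0)
  · rw [hμ]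
    refine Measure.ae_smul_measure ?_ _
    filter_upwards [ae_restrict_mem hQcompact.measurableSet] with x hx using hM x hx
  · intro s t a b ha hb hab
    have h := (prekopaLeindler_euclideanSpace n).measure_rpow_mul_le ha hb hab
      ((hge s).inter hQcompact.measurableSet) ((hge t).inter hQcompact.measurableSet)
      ((hge (a * s + b * t)).inter hQcompact.measurableSet) (by
        rintro x ⟨hx, hxQ⟩ y ⟨hy, hyQ⟩
        refine ⟨?_, hQconvex hxQ hyQ ha.le hb.le hab⟩
        simp only [Set.mem_ofPred_eq] at hx hy ⊢
        rw [inner_add_right, inner_smul_right, inner_smul_right]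
        gcongr)
    have h' := ENNReal.toReal_mono (hfin _) h
    rw [ENNReal.toReal_mul, ← ENNReal.toReal_rpow, ← ENNReal.toReal_rpow] at h'
    rw [hreal _ (hge _), hreal _ (hge _), hreal _ (hge _), Real.mul_rpow (by positivity)
      (by positivity), Real.mul_rpow (by positivity) (by positivity), mul_mul_mul_comm,
      ← Real.rpow_add (by positivity), hab, Real.rpow_one]
    gcongr
  · intro ρ h0 h1 s
    refine hhom _ _ (hge _) (hge _) y₀ hy₀ ρ h0 h1 fun x hx => ?_
    simp only [Set.mem_ofPred_eq] at hx ⊢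
    rw [inner_add_right, inner_smul_right, inner_smul_right]
    nlinarith
  · intro ρ h0 h1 s
    refine hhom _ _ (hlt _) (hlt _) x₀ hx₀ ρ h0 h1 fun x hx => ?_
    simp only [Set.mem_ofPred_eq] at hx ⊢
    rw [inner_add_right, inner_smul_right, inner_smul_right]
    nlinarith
  · refine hcent.trans_eq ?_
    have hid : IntegrableOn (fun x : EuclideanSpace ℝ (Fin n) => x) Q :=
      continuous_id.continuousOn.integrableOn_compact hQcompact
    rw [inner_smul_right, hμ, integral_smul_measure, ENNReal.toReal_inv, smul_eq_mul,
      integral_inner hid]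
end
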